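/- arXiv:2302.11024 — 4 statements merged into one kernel-verified Lean document; each statement's English description precedes it below -/
import Mathlib

section
/- Let Φ_R : ℝ^d → ℝ be twice continuously differentiable with α·I ⪯ Hess Φ_R(θ) ⪯ β·I for all θ, for some 0 < α ≤ β, and suppose ρ_post := e^{−Φ_R} is a probability density (so ρ_post is α-strongly logconcave). Let m : [0,∞) → ℝ^d and C : [0,∞) → ℝ^{d×d} be differentiable with C(t) symmetric positive definite for all t, solving the Gaussian approximate Wasserstein gradient flow: m'(t) = −∫ ∇Φ_R(θ)·ρ_{m(t),C(t)}(θ) dθ and C'(t) = 2I − H(t)·C(t) − C(t)·H(t), where H(t) := ∫ Hess Φ_R(θ)·ρ_{m(t),C(t)}(θ) dθ. Let (m*, C*), with C* symmetric positive definite, be a global minimizer of (m,C) ↦ KL[ρ_{m,C}‖ρ_post] over all m ∈ ℝ^d and symmetric positive-definite C. Then for all t ≥ 0, KL[ρ_{m(t),C(t)}‖ρ_post] ≤ e^{−2αt}·KL[ρ_{m(0),C(0)}‖ρ_post] + (1 − e^{−2αt})·KL[ρ_{m*,C*}‖ρ_post]. -/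
open MeasureTheory

/-- The Gaussian density on `ℝ^d` with mean `m` and covariance `C`. -/
noncomputable def gaussDensity {d : ℕ} (m : EuclideanSpace ℝ (Fin d))
    (C : Matrix (Fin d) (Fin d) ℝ) (θ : EuclideanSpace ℝ (Fin d)) : ℝ :=
  (Real.sqrt ((2 * Real.pi) ^ d * C.det))⁻¹ *
    Real.exp (-(1 / 2) * ∑ i, ∑ j, (θ i - m i) * C⁻¹ i j * (θ j - m j))

section Taylor

theorem nonneg_of_second_deriv_nonneg {f f' f'' : ℝ → ℝ} (hf : ∀ s, HasDerivAt f (f' s) s)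
    (hf' : ∀ s, HasDerivAt f' (f'' s) s) (hf'' : ∀ s, 0 ≤ f'' s) (h0 : f 0 = 0) (h0' : f' 0 = 0) :
    0 ≤ f 1 := by
  have hmono' : Monotone f' := monotone_of_hasDerivAt_nonneg hf' hf''
  have hmono : MonotoneOn f (Set.Ici 0) := by
    refine monotoneOn_of_hasDerivWithinAt_nonneg (f' := f') (convex_Ici 0)
      (fun s _ => (hf s).continuousAt.continuousWithinAt)
      (fun s _ => (hf s).hasDerivWithinAt) fun s hs => ?_
    rw [interior_Ici] at hs
    exact h0' ▸ hmono' (le_of_lt hs)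
  exact h0 ▸ hmono (by simp) (by simp) zero_le_one

variable {E : Type*} [NormedAddCommGroup E] [InnerProductSpace ℝ E] {Φ : E → ℝ} {α β : ℝ}

theorem differentiable_fderiv_of_contDiff_two (hΦ : ContDiff ℝ 2 Φ) :
    Differentiable ℝ (fderiv ℝ Φ) :=
  (hΦ.fderiv_right (m := 1) (by norm_num)).differentiable (by norm_num)

theorem taylor_two_lower (hΦ : ContDiff ℝ 2 Φ)
    (h : ∀ θ v, α * ‖v‖ ^ 2 ≤ fderiv ℝ (fderiv ℝ Φ) θ v v) (x v : E) :
    Φ x + fderiv ℝ Φ x v + α / 2 * ‖v‖ ^ 2 ≤ Φ (x + v) := by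
  have hl (s : ℝ) : HasDerivAt (fun s : ℝ => x + s • v) v s := by
    simpa using ((hasDerivAt_id s).smul_const v).const_add x
  have h1 (s : ℝ) : HasDerivAt (fun s : ℝ => Φ (x + s • v)) (fderiv ℝ Φ (x + s • v) v) s :=
    ((hΦ.differentiable (by norm_num) _).hasFDerivAt).comp_hasDerivAt s (hl s)
  have h2 (s : ℝ) : HasDerivAt (fun s : ℝ => fderiv ℝ Φ (x + s • v) v)
      (fderiv ℝ (fderiv ℝ Φ) (x + s • v) v v) s := by
    have := (((differentiable_fderiv_of_contDiff_two hΦ) (x + s • v)).hasFDerivAt).comp_hasDerivAt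
      s (hl s)
    exact (ContinuousLinearMap.apply ℝ ℝ v).hasFDerivAt.comp_hasDerivAt s this
  have key := nonneg_of_second_deriv_nonneg
    (f := fun s => Φ (x + s • v) - Φ x - s * fderiv ℝ Φ x v - α / 2 * ‖v‖ ^ 2 * s ^ 2)
    (f' := fun s => fderiv ℝ Φ (x + s • v) v - fderiv ℝ Φ x v - α * ‖v‖ ^ 2 * s)
    (f'' := fun s => fderiv ℝ (fderiv ℝ Φ) (x + s • v) v v - α * ‖v‖ ^ 2)
    (fun s => by
      convert! (((h1 s).sub_const (Φ x)).sub ((hasDerivAt_id s).mul_const (fderiv ℝ Φ x v))).sub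
        (((hasDerivAt_id s).pow 2).const_mul (α / 2 * ‖v‖ ^ 2)) using 1
      simp only [id]; ring)
    (fun s => by
      convert! ((h2 s).sub_const (fderiv ℝ Φ x v)).sub
        ((hasDerivAt_id s).const_mul (α * ‖v‖ ^ 2)) using 1
      ring)
    (fun s => sub_nonneg.2 (h _ _)) (by simp) (by simp)
  simp only [one_smul, one_mul, one_pow, mul_one] at key
  linarith

theorem taylor_two_upper (hΦ : ContDiff ℝ 2 Φ)
    (h : ∀ θ v, fderiv ℝ (fderiv ℝ Φ) θ v v ≤ β * ‖v‖ ^ 2) (x v : E) :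
    Φ (x + v) ≤ Φ x + fderiv ℝ Φ x v + β / 2 * ‖v‖ ^ 2 := by
  have h1 : fderiv ℝ (fun y => -Φ y) = fun y => -fderiv ℝ Φ y := by
    ext1 y; exact fderiv_fun_neg
  have := taylor_two_lower (Φ := fun y => -Φ y) (α := -β) hΦ.neg (fun θ v => by
    rw [h1, fderiv_fun_neg]
    have := h θ v
    simp only [neg_mul, neg_apply]
    linarith) x v
  rw [h1] at this
  simp only [neg_apply] at this
  linarith

theorem abs_hessian_le (hΦ : ContDiff ℝ 2 Φ)
    (h0 : ∀ θ v, 0 ≤ fderiv ℝ (fderiv ℝ Φ) θ v v)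
    (h : ∀ θ v, fderiv ℝ (fderiv ℝ Φ) θ v v ≤ β * ‖v‖ ^ 2) (hβ : 0 ≤ β) (θ u v : E) :
    |fderiv ℝ (fderiv ℝ Φ) θ u v| ≤ β * ‖u‖ * ‖v‖ := by
  have hsymm : ∀ u v, fderiv ℝ (fderiv ℝ Φ) θ u v = fderiv ℝ (fderiv ℝ Φ) θ v u :=
    (hΦ.contDiffAt.isSymmSndFDerivAt (by simp)).eq
  have hsq := LinearMap.BilinForm.apply_sq_le_of_symm
    ((fderiv ℝ (fderiv ℝ Φ) θ).toLinearMap₁₂) (by simpa using h0 θ)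
    ⟨by intro u v; simpa using hsymm u v⟩ u v
  simp only [ContinuousLinearMap.toLinearMap₁₂_apply] at hsq
  refine abs_le_of_sq_le_sq ?_ (by positivity)
  calc _ ≤ _ := hsq
    _ ≤ (β * ‖u‖ ^ 2) * (β * ‖v‖ ^ 2) :=
      mul_le_mul (h θ u) (h θ v) (h0 θ v) (by positivity)
    _ = _ := by ring

theorem norm_fderiv_le_of_hessian_le (hΦ : ContDiff ℝ 2 Φ)
    (h0 : ∀ θ v, 0 ≤ fderiv ℝ (fderiv ℝ Φ) θ v v)
    (h : ∀ θ v, fderiv ℝ (fderiv ℝ Φ) θ v v ≤ β * ‖v‖ ^ 2) (hβ : 0 ≤ β) (x : E) :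
    ‖fderiv ℝ Φ x‖ ≤ ‖fderiv ℝ Φ 0‖ + β * ‖x‖ := by
  have hb : ∀ θ, ‖fderiv ℝ (fderiv ℝ Φ) θ‖ ≤ β := fun θ =>
    ContinuousLinearMap.opNorm_le_bound₂ _ hβ fun u v => abs_hessian_le hΦ h0 h hβ θ u v
  have := Convex.norm_image_sub_le_of_norm_fderiv_le (𝕜 := ℝ) (f := fderiv ℝ Φ) (s := Set.univ)
    (fun y _ => differentiable_fderiv_of_contDiff_two hΦ y) (fun y _ => hb y) convex_univ
    (Set.mem_univ 0) (Set.mem_univ x)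
  rw [sub_zero] at this
  linarith [norm_le_norm_add_norm_sub' (fderiv ℝ Φ x) (fderiv ℝ Φ 0)]

theorem exists_abs_le_of_hessian_le (hΦ : ContDiff ℝ 2 Φ)
    (h0 : ∀ θ v, 0 ≤ fderiv ℝ (fderiv ℝ Φ) θ v v)
    (h : ∀ θ v, fderiv ℝ (fderiv ℝ Φ) θ v v ≤ β * ‖v‖ ^ 2) (hβ : 0 ≤ β) :
    ∃ c, ∀ x, ‖Φ x‖ ≤ c * (1 + ‖x‖ ^ 2) := by
  refine ⟨|Φ 0| + ‖fderiv ℝ Φ 0‖ + β / 2, fun x => ?_⟩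
  have h1 := taylor_two_upper hΦ h 0 x
  have h2 := taylor_two_lower (α := 0) hΦ (by simpa using h0) 0 x
  have h3 := abs_le.1 ((fderiv ℝ Φ 0).le_opNorm x)
  have h4 : ‖x‖ ≤ 1 + ‖x‖ ^ 2 := by nlinarith [sq_nonneg (‖x‖ - 1)]
  have h5 := mul_le_mul_of_nonneg_left h4 (norm_nonneg (fderiv ℝ Φ 0))
  have h6 := abs_le.1 (le_refl |Φ 0|)
  have h7 : 0 ≤ |Φ 0| * ‖x‖ ^ 2 := by positivity
  rw [zero_add] at h1 h2
  have h8 : 0 ≤ β / 2 * ‖x‖ ^ 2 := by positivity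
  rw [Real.norm_eq_abs, abs_le]
  constructor <;> nlinarith [h3.1, h3.2, h6.1, h6.2]

end Taylor

section StandardGaussian

variable {d : ℕ}

local notation "𝔼" => EuclideanSpace ℝ (Fin d)
local notation "lin" => Matrix.toEuclideanCLM (n := Fin d) (𝕜 := ℝ)

theorem gaussDensity_zero_one (z : 𝔼) :
    gaussDensity 0 1 z = (Real.sqrt ((2 * Real.pi) ^ d))⁻¹ * Real.exp (-(1 / 2) * ‖z‖ ^ 2) := by
  rw [EuclideanSpace.norm_sq_eq]
  simp [gaussDensity, Matrix.one_apply, pow_two]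

theorem continuous_gaussDensity_zero_one : Continuous (gaussDensity (d := d) 0 1) := by
  rw [funext gaussDensity_zero_one]
  fun_prop

theorem gaussDensity_zero_one_nonneg (z : 𝔼) : 0 ≤ gaussDensity 0 1 z := by
  rw [gaussDensity_zero_one]; positivity

/-- The standard Gaussian measure on `ℝ^d`. -/
noncomputable def stdGaussMeasure (d : ℕ) : Measure (EuclideanSpace ℝ (Fin d)) :=
  volume.withDensity fun z => ENNReal.ofReal (gaussDensity 0 1 z)

theorem integral_stdGaussMeasure {F : Type*} [NormedAddCommGroup F] [NormedSpace ℝ F] (f : 𝔼 → F) :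
    ∫ z, f z ∂stdGaussMeasure d = ∫ z, gaussDensity 0 1 z • f z := by
  rw [stdGaussMeasure, integral_withDensity_eq_integral_toReal_smul
    continuous_gaussDensity_zero_one.measurable.ennreal_ofReal (by simp)]
  simp [ENNReal.toReal_ofReal (gaussDensity_zero_one_nonneg _)]

theorem integrable_stdGaussMeasure_iff {F : Type*} [NormedAddCommGroup F] [NormedSpace ℝ F]
    {f : 𝔼 → F} :
    Integrable f (stdGaussMeasure d) ↔ Integrable fun z => gaussDensity 0 1 z • f z := by
  rw [stdGaussMeasure, integrable_withDensity_iff_integrable_smul'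
    continuous_gaussDensity_zero_one.measurable.ennreal_ofReal (by simp)]
  simp [ENNReal.toReal_ofReal (gaussDensity_zero_one_nonneg _)]

theorem integrable_exp_neg_mul_norm_sq {b : ℝ} (hb : 0 < b) :
    Integrable fun z : 𝔼 => Real.exp (-b * ‖z‖ ^ 2) := by
  have := (GaussianFourier.integrable_cexp_neg_mul_sq_norm_add (V := 𝔼) (b := b)
    (by simpa using hb) 0 0).norm
  refine this.congr (.of_forall fun z => ?_)
  simp [Complex.norm_exp, ← Complex.ofReal_pow]

theorem integrable_stdGaussMeasure_of_le {F : Type*} [NormedAddCommGroup F] [NormedSpace ℝ F]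
    {f : 𝔼 → F} (hf : Continuous f) {c : ℝ} (hc : ∀ z, ‖f z‖ ≤ c * (1 + ‖z‖ ^ 2)) :
    Integrable f (stdGaussMeasure d) := by
  rw [integrable_stdGaussMeasure_iff]
  refine ((integrable_exp_neg_mul_norm_sq (d := d) (b := 1 / 4) (by norm_num)).const_mul
    ((Real.sqrt ((2 * Real.pi) ^ d))⁻¹ * (4 * c))).mono'
    (continuous_gaussDensity_zero_one.smul hf).aestronglyMeasurable (.of_forall fun z => ?_)
  have hc0 : 0 ≤ c := by simpa using (norm_nonneg _).trans (hc 0)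
  rw [norm_smul, Real.norm_of_nonneg (gaussDensity_zero_one_nonneg z), gaussDensity_zero_one]
  have h1 : 1 + ‖z‖ ^ 2 ≤ 4 * Real.exp (1 / 4 * ‖z‖ ^ 2) := by
    nlinarith [Real.add_one_le_exp (1 / 4 * ‖z‖ ^ 2)]
  have h2 : Real.exp (-(1 / 2) * ‖z‖ ^ 2) * Real.exp (1 / 4 * ‖z‖ ^ 2)
      = Real.exp (-(1 / 4) * ‖z‖ ^ 2) := by
    rw [← Real.exp_add]; ring_nf
  calc _ ≤ (Real.sqrt ((2 * Real.pi) ^ d))⁻¹ * Real.exp (-(1 / 2) * ‖z‖ ^ 2) *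
        (c * (4 * Real.exp (1 / 4 * ‖z‖ ^ 2))) := by
        gcongr
        exact (hc z).trans (by gcongr)
    _ = _ := by rw [← h2]; ring

instance isProbabilityMeasure_stdGaussMeasure : IsProbabilityMeasure (stdGaussMeasure d) := by
  have h : ∫ _ : 𝔼, (1 : ℝ) ∂stdGaussMeasure d = 1 := by
    rw [integral_stdGaussMeasure]
    simp_rw [smul_eq_mul, mul_one, gaussDensity_zero_one]
    rw [integral_const_mul, GaussianFourier.integral_rexp_neg_mul_sq_norm (by norm_num)]
    rw [finrank_euclideanSpace_fin, show Real.pi / (1 / 2) = 2 * Real.pi by ring,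
      Real.sqrt_eq_rpow, ← Real.rpow_natCast, ← Real.rpow_mul (by positivity), mul_one_div]
    exact inv_mul_cancel₀ (by positivity)
  refine ⟨?_⟩
  simp only [integral_const, smul_eq_mul, mul_one] at h
  exact (ENNReal.toReal_eq_one_iff _).1 h

theorem gaussDensity_add_toEuclideanCLM (m : 𝔼) {A : Matrix (Fin d) (Fin d) ℝ} (hA : A.det ≠ 0)
    (z : 𝔼) :
    gaussDensity m (A * A.transpose) (m + lin A z) = |A.det|⁻¹ * gaussDensity 0 1 z := by
  have hu : IsUnit A.det := isUnit_iff_ne_zero.2 hA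
  have hq : ∑ i, ∑ j, ((m + lin A z) i - m i) * (A * A.transpose)⁻¹ i j *
      ((m + lin A z) j - m j) = ‖z‖ ^ 2 := by
    have h1 : ∑ i, ∑ j, ((m + lin A z) i - m i) * (A * A.transpose)⁻¹ i j *
      ((m + lin A z) j - m j) = (A.mulVec z) ⬝ᵥ (A * A.transpose)⁻¹.mulVec (A.mulVec z) := by
      simp [dotProduct, Matrix.mulVec, Finset.mul_sum, mul_assoc]
    rw [h1, Matrix.mulVec_mulVec, Matrix.mul_inv_rev, mul_assoc, Matrix.nonsing_inv_mul _ hu,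
      mul_one, ← Matrix.transpose_nonsing_inv, Matrix.dotProduct_mulVec, Matrix.vecMul_transpose,
      Matrix.mulVec_mulVec, Matrix.nonsing_inv_mul _ hu, Matrix.one_mulVec,
      EuclideanSpace.norm_sq_eq]
    simp [dotProduct, pow_two]
  rw [gaussDensity, hq, gaussDensity_zero_one, Matrix.det_mul, Matrix.det_transpose,
    Real.sqrt_mul (by positivity), Real.sqrt_mul_self_eq_abs, mul_inv]
  ring

theorem integral_gaussDensity_smul {F : Type*} [NormedAddCommGroup F] [NormedSpace ℝ F]
    (m : 𝔼) {A : Matrix (Fin d) (Fin d) ℝ} (hA : A.det ≠ 0) (f : 𝔼 → F) :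
    ∫ θ, gaussDensity m (A * A.transpose) θ • f θ =
      ∫ z, f (m + lin A z) ∂stdGaussMeasure d := by
  have hdet : LinearMap.det (Matrix.toEuclideanLin A) = A.det := LinearMap.det_toLpLin 2 A
  have hmap := Measure.map_linearMap_addHaar_eq_smul_addHaar (volume : Measure 𝔼)
    (f := Matrix.toEuclideanLin A) (hdet ▸ hA)
  have hemb : MeasurableEmbedding (Matrix.toEuclideanLin A) :=
    ((Matrix.toEuclideanLin A).equivOfDetNeZero
      (hdet ▸ hA)).toContinuousLinearEquiv.toHomeomorph.measurableEmbedding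
  rw [hdet] at hmap
  rw [integral_stdGaussMeasure, ← integral_add_left_eq_self _ m]
  have h := hemb.integral_map (μ := volume) fun θ =>
    gaussDensity m (A * A.transpose) (m + θ) • f (m + θ)
  have h' : ∀ z, gaussDensity m (A * A.transpose) (m + Matrix.toEuclideanLin A z) =
    |A.det|⁻¹ * gaussDensity 0 1 z := gaussDensity_add_toEuclideanCLM m hA
  rw [hmap, integral_smul_measure, ENNReal.toReal_ofReal (abs_nonneg _)] at h
  simp_rw [h', mul_smul] at h
  rw [integral_smul, abs_inv] at h
  exact smul_right_injective F (inv_ne_zero (abs_ne_zero.2 hA)) h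

theorem hasFDerivAt_gaussDensity_zero_one (z : 𝔼) :
    HasFDerivAt (gaussDensity 0 1) (-gaussDensity 0 1 z • innerSL ℝ z) z := by
  rw [funext gaussDensity_zero_one]
  convert! (((hasStrictFDerivAt_norm_sq z).hasFDerivAt.const_mul (-(1 / 2) : ℝ)).exp).const_mul
    ((Real.sqrt ((2 * Real.pi) ^ d))⁻¹) using 1
  ext v
  simp
  ring

theorem integrable_coord_mul_stdGaussMeasure {g : 𝔼 → ℝ} (hg : Continuous g) {c : ℝ}
    (hc : ∀ z, ‖g z‖ ≤ c * (1 + ‖z‖)) (k : Fin d) :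
    Integrable (fun z : 𝔼 => z k * g z) (stdGaussMeasure d) := by
  have hc0 : 0 ≤ c := by simpa using (norm_nonneg _).trans (hc 0)
  have hle (z : 𝔼) : ‖z‖ ≤ 1 + ‖z‖ ^ 2 := by nlinarith [sq_nonneg (‖z‖ - 1)]
  refine integrable_stdGaussMeasure_of_le (c := 2 * c) (by fun_prop) fun z => ?_
  calc _ = ‖z k‖ * ‖g z‖ := norm_mul _ _
    _ ≤ ‖z‖ * (c * (1 + ‖z‖)) := by
      gcongr
      · exact PiLp.norm_apply_le z k
      · exact hc z
    _ ≤ _ := by nlinarith [hle z, mul_le_mul_of_nonneg_left (hle z) hc0]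

theorem integral_coord_mul_stdGaussMeasure {g : 𝔼 → ℝ} (hg : ContDiff ℝ 1 g) {c c' : ℝ}
    (hc : ∀ z, ‖g z‖ ≤ c * (1 + ‖z‖)) (hc' : ∀ z, ‖fderiv ℝ g z‖ ≤ c') (k : Fin d) :
    ∫ z, z k * g z ∂stdGaussMeasure d =
      ∫ z, fderiv ℝ g z (EuclideanSpace.single k 1) ∂stdGaussMeasure d := by
  have hc0 : 0 ≤ c := by simpa using (norm_nonneg _).trans (hc 0)
  have hc0' : 0 ≤ c' := (norm_nonneg _).trans (hc' 0)
  have hle (z : 𝔼) : ‖z‖ ≤ 1 + ‖z‖ ^ 2 := by nlinarith [sq_nonneg (‖z‖ - 1)]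
  have hfd (z : 𝔼) : fderiv ℝ (gaussDensity 0 1) z (EuclideanSpace.single k 1) =
      -(gaussDensity 0 1 z * z k) := by
    rw [(hasFDerivAt_gaussDensity_zero_one z).fderiv]
    simp [EuclideanSpace.inner_single_right]
  have i1 := integrable_coord_mul_stdGaussMeasure hg.continuous hc k
  have i2 : Integrable (fun z : 𝔼 => fderiv ℝ g z (EuclideanSpace.single k 1))
      (stdGaussMeasure d) := by
    refine integrable_stdGaussMeasure_of_le (c := c')
      ((hg.continuous_fderiv (by norm_num)).clm_apply continuous_const) fun z => ?_
    refine ((fderiv ℝ g z).le_opNorm _).trans ?_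
    simp only [PiLp.norm_single, norm_one, mul_one]
    nlinarith [hc' z, sq_nonneg ‖z‖]
  have i3 : Integrable g (stdGaussMeasure d) := by
    refine integrable_stdGaussMeasure_of_le (c := 2 * c) hg.continuous fun z => ?_
    nlinarith [hc z, hle z, mul_le_mul_of_nonneg_left (hle z) hc0]
  rw [integrable_stdGaussMeasure_iff] at i1 i2 i3
  have := integral_mul_fderiv_eq_neg_fderiv_mul_of_integrable (μ := (volume : Measure 𝔼))
    (f := gaussDensity 0 1) (g := g) (v := EuclideanSpace.single k 1)
    (by simpa [hfd, mul_assoc] using i1.neg) (by simpa using i2) (by simpa using i3)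
    (fun z _ => (hasFDerivAt_gaussDensity_zero_one z).differentiableAt)
    (fun z _ => hg.differentiable (by norm_num) z)
  rw [integral_stdGaussMeasure, integral_stdGaussMeasure]
  simp only [smul_eq_mul]
  rw [this, ← integral_neg]
  congr with z
  rw [hfd]
  ring

theorem integral_coord_stdGaussMeasure (k : Fin d) : ∫ z : 𝔼, z k ∂stdGaussMeasure d = 0 := by
  simpa using integral_coord_mul_stdGaussMeasure (d := d) (g := fun _ => 1) contDiff_const (c := 1)
    (c' := 0) (by intro z; simp) (by simp) k

theorem integral_coord_mul_coord_stdGaussMeasure (i j : Fin d) :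
    ∫ z : 𝔼, z i * z j ∂stdGaussMeasure d = if i = j then 1 else 0 := by
  have hf (z : 𝔼) : fderiv ℝ (fun z : 𝔼 => z j) z = EuclideanSpace.proj j :=
    (EuclideanSpace.proj (𝕜 := ℝ) j).hasFDerivAt.fderiv
  have := integral_coord_mul_stdGaussMeasure (d := d) (g := fun z => z j) (by fun_prop) (c := 1)
    (c' := ‖(EuclideanSpace.proj j : 𝔼 →L[ℝ] ℝ)‖)
    (fun z => by linarith [PiLp.norm_apply_le z j]) (fun z => by rw [hf]) i
  rw [this]
  simp [hf, eq_comm]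

end StandardGaussian

section GaussianExpectation

/-- `Φ` is of class `C²` with Hessian between `α I` and `β I`, where `0 ≤ α ≤ β`. -/
structure HessianBetween {E : Type*} [NormedAddCommGroup E] [InnerProductSpace ℝ E]
    (Φ : E → ℝ) (α β : ℝ) : Prop where
  contDiff : ContDiff ℝ 2 Φ
  nonneg : 0 ≤ α
  le : α ≤ β
  lower : ∀ θ v, α * ‖v‖ ^ 2 ≤ fderiv ℝ (fderiv ℝ Φ) θ v v
  upper : ∀ θ v, fderiv ℝ (fderiv ℝ Φ) θ v v ≤ β * ‖v‖ ^ 2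

namespace HessianBetween

variable {E : Type*} [NormedAddCommGroup E] [InnerProductSpace ℝ E] {Φ : E → ℝ} {α β : ℝ}

theorem hessian_nonneg (h : HessianBetween Φ α β) (θ v : E) :
    0 ≤ fderiv ℝ (fderiv ℝ Φ) θ v v :=
  (mul_nonneg h.nonneg (sq_nonneg _)).trans (h.lower θ v)

theorem abs_hessian_le (h : HessianBetween Φ α β) (θ u v : E) :
    |fderiv ℝ (fderiv ℝ Φ) θ u v| ≤ β * ‖u‖ * ‖v‖ :=
  _root_.abs_hessian_le h.contDiff h.hessian_nonneg h.upper (h.nonneg.trans h.le) θ u v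

theorem exists_norm_fderiv_le (h : HessianBetween Φ α β) :
    ∃ c, 0 ≤ c ∧ ∀ x, ‖fderiv ℝ Φ x‖ ≤ c * (1 + ‖x‖) := by
  have hβ := h.nonneg.trans h.le
  refine ⟨‖fderiv ℝ Φ 0‖ + β, by positivity, fun x => ?_⟩
  have := norm_fderiv_le_of_hessian_le h.contDiff h.hessian_nonneg h.upper hβ x
  have h2 : 0 ≤ ‖fderiv ℝ Φ 0‖ * ‖x‖ := by positivity
  nlinarith

theorem continuous_hessian_apply (h : HessianBetween Φ α β) (u v : E) :
    Continuous fun x => fderiv ℝ (fderiv ℝ Φ) x u v :=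
  (((h.contDiff.fderiv_right (m := 1) (by norm_num)).continuous_fderiv
    (by norm_num)).clm_apply continuous_const).clm_apply continuous_const

end HessianBetween

variable {d : ℕ} {α β : ℝ}

local notation "𝔼" => EuclideanSpace ℝ (Fin d)
local notation "lin" => Matrix.toEuclideanCLM (n := Fin d) (𝕜 := ℝ)

theorem integrable_comp_affine_stdGaussMeasure {F : Type*} [NormedAddCommGroup F]
    [NormedSpace ℝ F] {f : 𝔼 → F} (hf : Continuous f) {c : ℝ}
    (hc : ∀ x, ‖f x‖ ≤ c * (1 + ‖x‖ ^ 2)) (m : 𝔼) (T : 𝔼 →L[ℝ] 𝔼) :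
    Integrable (fun z => f (m + T z)) (stdGaussMeasure d) := by
  have hc0 : 0 ≤ c := by simpa using (norm_nonneg _).trans (hc 0)
  refine integrable_stdGaussMeasure_of_le (c := c * (1 + 2 * ‖m‖ ^ 2 + 2 * ‖T‖ ^ 2))
    (by fun_prop) fun z => (hc _).trans ?_
  rw [mul_assoc]
  gcongr
  have h1 : ‖m + T z‖ ≤ ‖m‖ + ‖T‖ * ‖z‖ := (norm_add_le _ _).trans (by gcongr; exact T.le_opNorm z)
  have h2 : ‖m + T z‖ ^ 2 ≤ (‖m‖ + ‖T‖ * ‖z‖) ^ 2 := by gcongr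
  have h3 : 0 ≤ ‖m‖ ^ 2 * ‖z‖ ^ 2 := by positivity
  nlinarith [sq_nonneg (‖m‖ - ‖T‖ * ‖z‖), sq_nonneg ‖T‖, sq_nonneg ‖z‖]

theorem lin_apply_eq_sum (D : Matrix (Fin d) (Fin d) ℝ) (z : 𝔼) :
    lin D z = ∑ i, ∑ k, (D i k * z k) • EuclideanSpace.single i (1 : ℝ) := by
  ext i
  simp [Matrix.mulVec, dotProduct, Pi.single_apply, ← Finset.sum_smul]

theorem lin_single (A : Matrix (Fin d) (Fin d) ℝ) (k : Fin d) :
    lin A (EuclideanSpace.single k 1) = ∑ l, A l k • EuclideanSpace.single l (1 : ℝ) := by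
  ext i
  simp [Pi.single_apply]

theorem integrable_coord_stdGaussMeasure (k : Fin d) :
    Integrable (fun z : 𝔼 => z k) (stdGaussMeasure d) := by
  simpa using integrable_coord_mul_stdGaussMeasure (d := d) (g := fun _ => 1) continuous_const
    (c := 1) (by intro z; simp) k

theorem integrable_coord_mul_coord_stdGaussMeasure (i j : Fin d) :
    Integrable (fun z : 𝔼 => z i * z j) (stdGaussMeasure d) :=
  integrable_coord_mul_stdGaussMeasure (by fun_prop) (c := 1)
    (fun z => by linarith [PiLp.norm_apply_le z j]) i

theorem integral_norm_sq_affine_stdGaussMeasure (δ : 𝔼) (D : Matrix (Fin d) (Fin d) ℝ) :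
    ∫ z, ‖δ + lin D z‖ ^ 2 ∂stdGaussMeasure d = ‖δ‖ ^ 2 + ∑ i, ∑ k, D i k ^ 2 := by
  have h (z : 𝔼) : ‖δ + lin D z‖ ^ 2 = ∑ i, (δ i ^ 2 + ∑ k, 2 * δ i * D i k * z k +
      ∑ k, ∑ l, D i k * D i l * (z k * z l)) := by
    rw [EuclideanSpace.norm_sq_eq]
    refine Finset.sum_congr rfl fun i _ => ?_
    simp only [PiLp.add_apply, Matrix.ofLp_toEuclideanCLM, Matrix.mulVec, dotProduct,
      Real.norm_eq_abs, sq_abs]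
    rw [add_sq, pow_two (∑ k, _), Finset.sum_mul_sum, Finset.mul_sum]
    congr 1
    · congr 1
      exact Finset.sum_congr rfl fun k _ => by ring
    · exact Finset.sum_congr rfl fun k _ => Finset.sum_congr rfl fun l _ => by ring
  have i1 (i k : Fin d) : Integrable (fun z : 𝔼 => 2 * δ i * D i k * z k) (stdGaussMeasure d) :=
    (integrable_coord_stdGaussMeasure k).const_mul _
  have i2 (i k l : Fin d) : Integrable (fun z : 𝔼 => D i k * D i l * (z k * z l))
      (stdGaussMeasure d) := (integrable_coord_mul_coord_stdGaussMeasure k l).const_mul _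
  have i1' (i : Fin d) := integrable_finsetSum (μ := stdGaussMeasure d) Finset.univ
    fun k _ => i1 i k
  have i2'' (i k : Fin d) := integrable_finsetSum (μ := stdGaussMeasure d) Finset.univ
    fun l _ => i2 i k l
  have i2' (i : Fin d) := integrable_finsetSum (μ := stdGaussMeasure d) Finset.univ
    fun k _ => i2'' i k
  have i3 (i : Fin d) : Integrable (fun z : 𝔼 => δ i ^ 2 + ∑ k, 2 * δ i * D i k * z k)
      (stdGaussMeasure d) := (integrable_const _).add (i1' i)
  have i4 (i : Fin d) : Integrable (fun z : 𝔼 => δ i ^ 2 + ∑ k, 2 * δ i * D i k * z k +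
      ∑ k, ∑ l, D i k * D i l * (z k * z l)) (stdGaussMeasure d) := (i3 i).add (i2' i)
  simp_rw [h]
  rw [integral_finsetSum _ fun i _ => i4 i, EuclideanSpace.norm_sq_eq, ← Finset.sum_add_distrib]
  refine Finset.sum_congr rfl fun i _ => ?_
  rw [integral_add (i3 i) (i2' i), integral_add (integrable_const _) (i1' i),
    integral_finsetSum _ fun k _ => i1 i k,
    integral_finsetSum _ fun k _ => i2'' i k]
  simp_rw [integral_const_mul, integral_coord_stdGaussMeasure]
  simp_rw [integral_finsetSum _ fun l _ => i2 i _ l, integral_const_mul,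
    integral_coord_mul_coord_stdGaussMeasure]
  simp [pow_two]

/-- The expected Hessian of `Φ` under the Gaussian with mean `m` and covariance `A Aᵀ`. -/
noncomputable def gaussHessian (Φ : 𝔼 → ℝ) (m : 𝔼) (A : Matrix (Fin d) (Fin d) ℝ) :
    Matrix (Fin d) (Fin d) ℝ :=
  Matrix.of fun i j => ∫ z, fderiv ℝ (fderiv ℝ Φ) (m + lin A z)
    (EuclideanSpace.single i 1) (EuclideanSpace.single j 1) ∂stdGaussMeasure d

/-- The expected gradient of `Φ` under the Gaussian with mean `m` and covariance `A Aᵀ`. -/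
noncomputable def gaussGradient (Φ : 𝔼 → ℝ) (m : 𝔼) (A : Matrix (Fin d) (Fin d) ℝ) : 𝔼 :=
  ∫ z, gradient Φ (m + lin A z) ∂stdGaussMeasure d

namespace HessianBetween

variable {Φ : EuclideanSpace ℝ (Fin d) → ℝ}

theorem isSymm_gaussHessian (h : HessianBetween Φ α β) (m : 𝔼) (A : Matrix (Fin d) (Fin d) ℝ) :
    (gaussHessian Φ m A).IsSymm := by
  ext i j
  simp only [gaussHessian, Matrix.transpose_apply, Matrix.of_apply]
  congr with z
  exact (h.contDiff.contDiffAt.isSymmSndFDerivAt (by simp)).eq _ _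

theorem integrable_comp (h : HessianBetween Φ α β) (m : 𝔼) (T : 𝔼 →L[ℝ] 𝔼) :
    Integrable (fun z => Φ (m + T z)) (stdGaussMeasure d) := by
  obtain ⟨c, hc⟩ := exists_abs_le_of_hessian_le h.contDiff h.hessian_nonneg h.upper
    (h.nonneg.trans h.le)
  exact integrable_comp_affine_stdGaussMeasure h.contDiff.continuous hc m T

theorem continuous_fderiv (h : HessianBetween Φ α β) : Continuous (fderiv ℝ Φ) :=
  h.contDiff.continuous_fderiv (by norm_num)

theorem integrable_fderiv_comp (h : HessianBetween Φ α β) (m : 𝔼) (T : 𝔼 →L[ℝ] 𝔼) :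
    Integrable (fun z => fderiv ℝ Φ (m + T z)) (stdGaussMeasure d) := by
  obtain ⟨c, hc0, hc⟩ := h.exists_norm_fderiv_le
  refine integrable_comp_affine_stdGaussMeasure (c := 2 * c) h.continuous_fderiv
    (fun x => (hc x).trans ?_) m T
  nlinarith [mul_nonneg hc0 (sq_nonneg (‖x‖ - 1)), mul_nonneg hc0 (sq_nonneg ‖x‖)]

theorem integrable_gradient_comp (h : HessianBetween Φ α β) (m : 𝔼) (T : 𝔼 →L[ℝ] 𝔼) :
    Integrable (fun z => gradient Φ (m + T z)) (stdGaussMeasure d) :=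
  (InnerProductSpace.toDual ℝ 𝔼).symm.toContinuousLinearEquiv.toContinuousLinearMap.integrable_comp
    (h.integrable_fderiv_comp m T)

theorem inner_gaussGradient (h : HessianBetween Φ α β) (m : 𝔼) (A : Matrix (Fin d) (Fin d) ℝ)
    (v : 𝔼) :
    inner ℝ (gaussGradient Φ m A) v = ∫ z, fderiv ℝ Φ (m + lin A z) v ∂stdGaussMeasure d := by
  rw [gaussGradient, real_inner_comm, ← integral_inner (h.integrable_gradient_comp m (lin A))]
  congr with z
  rw [real_inner_comm, gradient, InnerProductSpace.toDual_symm_apply]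

theorem exists_norm_fderiv_comp_le (h : HessianBetween Φ α β) (m : 𝔼) (T : 𝔼 →L[ℝ] 𝔼) (i : Fin d) :
    ∃ c, ∀ z, ‖fderiv ℝ Φ (m + T z) (EuclideanSpace.single i 1)‖ ≤ c * (1 + ‖z‖) := by
  obtain ⟨c, hc0, hc⟩ := h.exists_norm_fderiv_le
  refine ⟨c * (1 + ‖m‖ + ‖T‖), fun z => ((fderiv ℝ Φ (m + T z)).le_opNorm _).trans ?_⟩
  simp only [PiLp.norm_single, norm_one, mul_one]
  refine (hc _).trans ?_
  rw [mul_assoc]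
  gcongr
  have h1 : ‖m + T z‖ ≤ ‖m‖ + ‖T‖ * ‖z‖ := (norm_add_le _ _).trans (by gcongr; exact T.le_opNorm z)
  nlinarith [mul_nonneg (norm_nonneg m) (norm_nonneg z), norm_nonneg T, norm_nonneg z]

theorem integral_coord_mul_fderiv (h : HessianBetween Φ α β) (m : 𝔼)
    (A : Matrix (Fin d) (Fin d) ℝ) (i k : Fin d) :
    ∫ z, z k * fderiv ℝ Φ (m + lin A z) (EuclideanSpace.single i 1) ∂stdGaussMeasure d =
      (gaussHessian Φ m A * A) i k := by
  obtain ⟨c, hc⟩ := h.exists_norm_fderiv_comp_le m (lin A) i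
  have hβ := h.nonneg.trans h.le
  have hC1 : ContDiff ℝ 1 fun z => fderiv ℝ Φ (m + lin A z) (EuclideanSpace.single i 1) :=
    ((h.contDiff.fderiv_right (m := 1) (by norm_num)).comp (by fun_prop)).clm_apply contDiff_const
  have hfd (z v : 𝔼) :
      fderiv ℝ (fun z => fderiv ℝ Φ (m + lin A z) (EuclideanSpace.single i 1)) z v =
        fderiv ℝ (fderiv ℝ Φ) (m + lin A z) (lin A v) (EuclideanSpace.single i 1) := by
    have h1 : HasFDerivAt (fun z => m + lin A z) (lin A) z := (lin A).hasFDerivAt.const_add m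
    have h2 := ((differentiable_fderiv_of_contDiff_two h.contDiff) (m + lin A z)).hasFDerivAt.comp
      z h1
    have h3 := (ContinuousLinearMap.apply ℝ ℝ (EuclideanSpace.single i (1 : ℝ) : 𝔼)).hasFDerivAt.comp
      z h2
    exact congrArg (fun L => L v) h3.fderiv
  rw [integral_coord_mul_stdGaussMeasure hC1 hc (c' := β * ‖lin A‖) (fun z => ?_) k]
  · simp_rw [hfd, lin_single, map_sum, map_smul, sum_apply,
      smul_apply, smul_eq_mul]
    rw [integral_finsetSum _ fun l _ => ?_]
    · rw [Matrix.mul_apply]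
      refine Finset.sum_congr rfl fun l _ => ?_
      rw [integral_const_mul, mul_comm, ← (h.isSymm_gaussHessian m A).apply i l]
      rfl
    · refine Integrable.const_mul (integrable_comp_affine_stdGaussMeasure (c := β)
        (h.continuous_hessian_apply _ _) (fun x => ?_) m (lin A)) _
      refine (h.abs_hessian_le x _ _).trans ?_
      simp only [PiLp.norm_single, norm_one, mul_one]
      nlinarith [sq_nonneg ‖x‖]
  · refine ContinuousLinearMap.opNorm_le_bound _ (by positivity) fun v => ?_
    rw [hfd]
    refine (h.abs_hessian_le _ _ _).trans ?_
    simp only [PiLp.norm_single, norm_one, mul_one]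
    rw [mul_assoc]
    gcongr
    exact (lin A).le_opNorm v

theorem integrable_coord_mul_fderiv (h : HessianBetween Φ α β) (m : 𝔼)
    (A : Matrix (Fin d) (Fin d) ℝ) (i k : Fin d) :
    Integrable (fun z => z k * fderiv ℝ Φ (m + lin A z) (EuclideanSpace.single i 1))
      (stdGaussMeasure d) := by
  obtain ⟨c, hc⟩ := h.exists_norm_fderiv_comp_le m (lin A) i
  exact integrable_coord_mul_stdGaussMeasure
    ((h.continuous_fderiv.comp (by fun_prop)).clm_apply continuous_const) hc k

theorem integrable_fderiv_apply_lin (h : HessianBetween Φ α β) (m : 𝔼)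
    (A D : Matrix (Fin d) (Fin d) ℝ) :
    Integrable (fun z => fderiv ℝ Φ (m + lin A z) (lin D z)) (stdGaussMeasure d) := by
  simp_rw [lin_apply_eq_sum D, map_sum, map_smul, smul_eq_mul, mul_assoc]
  exact integrable_finsetSum _ fun i _ => integrable_finsetSum _ fun k _ =>
    (h.integrable_coord_mul_fderiv m A i k).const_mul _

theorem integral_fderiv_apply_lin (h : HessianBetween Φ α β) (m : 𝔼)
    (A D : Matrix (Fin d) (Fin d) ℝ) :
    ∫ z, fderiv ℝ Φ (m + lin A z) (lin D z) ∂stdGaussMeasure d =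
      ∑ i, ∑ k, D i k * (gaussHessian Φ m A * A) i k := by
  simp_rw [lin_apply_eq_sum D, map_sum, map_smul, smul_eq_mul, mul_assoc]
  have hi (i k : Fin d) := (h.integrable_coord_mul_fderiv m A i k).const_mul (D i k)
  rw [integral_finsetSum _ fun i _ => integrable_finsetSum _ fun k _ => hi i k]
  refine Finset.sum_congr rfl fun i _ => ?_
  rw [integral_finsetSum _ fun k _ => hi i k]
  refine Finset.sum_congr rfl fun k _ => ?_
  rw [integral_const_mul, h.integral_coord_mul_fderiv]

theorem integrable_taylor (h : HessianBetween Φ α β) (c : ℝ) (m δ : 𝔼)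
    (A D : Matrix (Fin d) (Fin d) ℝ) :
    Integrable (fun z => Φ (m + lin A z) + fderiv ℝ Φ (m + lin A z) (δ + lin D z) +
      c / 2 * ‖δ + lin D z‖ ^ 2) (stdGaussMeasure d) := by
  simp_rw [map_add]
  exact ((h.integrable_comp m (lin A)).add
    (((h.integrable_fderiv_comp m (lin A)).apply_continuousLinearMap
    δ).add (h.integrable_fderiv_apply_lin m A D))).add
    ((integrable_comp_affine_stdGaussMeasure (f := fun x => ‖x‖ ^ 2) (by fun_prop) (c := 1)
      (fun x => by simp) δ (lin D)).const_mul _)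

theorem integral_taylor (h : HessianBetween Φ α β) (c : ℝ) (m δ : 𝔼)
    (A D : Matrix (Fin d) (Fin d) ℝ) :
    ∫ z, (Φ (m + lin A z) + fderiv ℝ Φ (m + lin A z) (δ + lin D z) +
      c / 2 * ‖δ + lin D z‖ ^ 2) ∂stdGaussMeasure d =
    ∫ z, Φ (m + lin A z) ∂stdGaussMeasure d + inner ℝ (gaussGradient Φ m A) δ +
      ∑ i, ∑ k, D i k * (gaussHessian Φ m A * A) i k +
      c / 2 * (‖δ‖ ^ 2 + ∑ i, ∑ k, D i k ^ 2) := by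
  simp_rw [map_add]
  have i1 := h.integrable_comp m (lin A)
  have i2 := (h.integrable_fderiv_comp m (lin A)).apply_continuousLinearMap δ
  have i3 := h.integrable_fderiv_apply_lin m A D
  have i4 := (integrable_comp_affine_stdGaussMeasure (f := fun x => ‖x‖ ^ 2) (by fun_prop) (c := 1)
      (fun x => by simp) δ (lin D)).const_mul (c / 2)
  have i23 : Integrable (fun z => fderiv ℝ Φ (m + lin A z) δ +
      fderiv ℝ Φ (m + lin A z) (lin D z)) (stdGaussMeasure d) := i2.add i3
  have i123 : Integrable (fun z => Φ (m + lin A z) + (fderiv ℝ Φ (m + lin A z) δ +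
      fderiv ℝ Φ (m + lin A z) (lin D z))) (stdGaussMeasure d) := i1.add i23
  rw [integral_add i123 i4, integral_add i1 i23, integral_add i2 i3,
    integral_const_mul, integral_norm_sq_affine_stdGaussMeasure, h.inner_gaussGradient,
    h.integral_fderiv_apply_lin]
  ring

theorem integral_comp_lower (h : HessianBetween Φ α β) (m δ : 𝔼)
    (A D : Matrix (Fin d) (Fin d) ℝ) :
    ∫ z, Φ (m + lin A z) ∂stdGaussMeasure d + inner ℝ (gaussGradient Φ m A) δ +
      ∑ i, ∑ k, D i k * (gaussHessian Φ m A * A) i k +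
      α / 2 * (‖δ‖ ^ 2 + ∑ i, ∑ k, D i k ^ 2) ≤
    ∫ z, Φ ((m + δ) + lin (A + D) z) ∂stdGaussMeasure d := by
  rw [← h.integral_taylor]
  refine integral_mono (h.integrable_taylor α m δ A D) (h.integrable_comp _ _) fun z => ?_
  have := taylor_two_lower h.contDiff h.lower (m + lin A z) (δ + lin D z)
  rwa [add_add_add_comm, ← add_apply, ← map_add] at this

theorem integral_comp_upper (h : HessianBetween Φ α β) (m δ : 𝔼)
    (A D : Matrix (Fin d) (Fin d) ℝ) :
    ∫ z, Φ ((m + δ) + lin (A + D) z) ∂stdGaussMeasure d ≤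
    ∫ z, Φ (m + lin A z) ∂stdGaussMeasure d + inner ℝ (gaussGradient Φ m A) δ +
      ∑ i, ∑ k, D i k * (gaussHessian Φ m A * A) i k +
      β / 2 * (‖δ‖ ^ 2 + ∑ i, ∑ k, D i k ^ 2) := by
  rw [← h.integral_taylor]
  refine integral_mono (h.integrable_comp _ _) (h.integrable_taylor β m δ A D) fun z => ?_
  have := taylor_two_upper h.contDiff h.upper (m + lin A z) (δ + lin D z)
  rwa [add_add_add_comm, ← add_apply, ← map_add] at this

end HessianBetween

end GaussianExpectation

section MatrixCalculus

open scoped Matrix.Norms.Operator MatrixOrder Matrix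
open Filter Topology

variable {d : ℕ}

theorem hasDerivAt_matrix {C : ℝ → Matrix (Fin d) (Fin d) ℝ} {C' : Matrix (Fin d) (Fin d) ℝ}
    {t : ℝ} : HasDerivAt C C' t ↔ ∀ i j, HasDerivAt (fun s => C s i j) (C' i j) t := by
  constructor
  · intro h i j
    have := (LinearMap.toContinuousLinearMap
      (Matrix.entryLinearMap ℝ ℝ i j)).hasFDerivAt.comp_hasDerivAt t h
    exact this
  · intro h
    have h1 : HasDerivAt (fun s => ∑ i, ∑ j, C s i j • Matrix.single i j (1 : ℝ))
        (∑ i, ∑ j, C' i j • Matrix.single i j (1 : ℝ)) t :=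
      HasDerivAt.fun_sum fun i _ => HasDerivAt.fun_sum fun j _ => (h i j).smul_const _
    have h2 (M : Matrix (Fin d) (Fin d) ℝ) :
        ∑ i, ∑ j, M i j • Matrix.single i j (1 : ℝ) = M := by
      conv_rhs => rw [Matrix.matrix_eq_sum_single M]
      simp [Matrix.smul_single]
    simpa only [h2] using h1

theorem Matrix.PosDef.exists_posDef_mul_self {C : Matrix (Fin d) (Fin d) ℝ} (hC : C.PosDef) :
    ∃ S : Matrix (Fin d) (Fin d) ℝ, S.PosDef ∧ S * S = C := by
  have h0 : 0 ≤ C := hC.posSemidef.nonneg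
  have hS := CFC.sqrt_mul_sqrt_self C h0
  refine ⟨CFC.sqrt C, ?_, hS⟩
  rw [(Matrix.nonneg_iff_posSemidef.1 (CFC.sqrt_nonneg C)).posDef_iff_det_ne_zero]
  intro h
  have := hC.det_pos
  rw [← hS, Matrix.det_mul, h] at this
  simp at this

theorem Matrix.PosDef.log_det_le_trace_sub {M : Matrix (Fin d) (Fin d) ℝ} (hM : M.PosDef) :
    Real.log M.det ≤ M.trace - d := by
  have hp := hM.eigenvalues_pos
  rw [hM.isHermitian.det_eq_prod_eigenvalues, hM.isHermitian.trace_eq_sum_eigenvalues]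
  simp only [RCLike.ofReal_real_eq_id, id]
  rw [Real.log_prod fun i _ => (hp i).ne']
  calc _ ≤ ∑ i, (hM.isHermitian.eigenvalues i - 1) :=
        Finset.sum_le_sum fun i _ => Real.log_le_sub_one_of_pos (hp i)
    _ = _ := by simp

theorem Matrix.PosDef.log_det_sub_log_det_le {A B : Matrix (Fin d) (Fin d) ℝ} (hA : A.PosDef)
    (hB : B.PosDef) : Real.log B.det - Real.log A.det ≤ (A⁻¹ * B).trace - d := by
  obtain ⟨S, hS, hSS⟩ := hA.inv.exists_posDef_mul_self
  have hM : (S * B * S).PosDef := by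
    have := hB.conjTranspose_mul_mul_same (B := S)
      (Matrix.mulVec_injective_of_isUnit hS.isUnit)
    rwa [hS.isHermitian.eq] at this
  have h := hM.log_det_le_trace_sub
  rw [Matrix.trace_mul_comm, ← mul_assoc, hSS] at h
  have hdet : (S * B * S).det = B.det / A.det := by
    have : S.det * S.det = A.det⁻¹ := by
      rw [← Matrix.det_mul, hSS, Matrix.det_nonsing_inv, Ring.inverse_eq_inv']
    rw [Matrix.det_mul, Matrix.det_mul, mul_right_comm, this]; ring
  rwa [hdet, Real.log_div hB.det_pos.ne' hA.det_pos.ne'] at h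

theorem hasDerivAt_matrix_inv {C : ℝ → Matrix (Fin d) (Fin d) ℝ} {C' : Matrix (Fin d) (Fin d) ℝ}
    {t : ℝ} (hC : HasDerivAt C C' t) (hdet : (C t).det ≠ 0) :
    HasDerivAt (fun s => (C s)⁻¹) (-((C t)⁻¹ * C' * (C t)⁻¹)) t := by
  obtain ⟨u, hu⟩ : IsUnit (C t) := (Matrix.isUnit_iff_isUnit_det _).2 hdet.isUnit
  have h := hasFDerivAt_ringInverse (𝕜 := ℝ) u
  rw [hu] at h
  have h2 := h.comp_hasDerivAt t hC
  simp only [Matrix.nonsing_inv_eq_ringInverse]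
  convert! h2 using 1
  simp [← hu]

theorem hasDerivAt_trace {C : ℝ → Matrix (Fin d) (Fin d) ℝ} {C' : Matrix (Fin d) (Fin d) ℝ}
    {t : ℝ} (hC : HasDerivAt C C' t) : HasDerivAt (fun s => (C s).trace) C'.trace t :=
  HasDerivAt.fun_sum fun i _ => hasDerivAt_matrix.1 hC i i

theorem HasDerivAt.squeeze {f g h : ℝ → ℝ} {c t : ℝ} (hf : HasDerivAt f c t)
    (hh : HasDerivAt h c t) (hft : f t = g t) (hht : h t = g t) (hfg : ∀ᶠ s in 𝓝 t, f s ≤ g s)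
    (hgh : ∀ᶠ s in 𝓝 t, g s ≤ h s) : HasDerivAt g c t := by
  rw [hasDerivAt_iff_isLittleO] at *
  rw [Asymptotics.isLittleO_iff] at *
  intro ε hε
  filter_upwards [hf hε, hh hε, hfg, hgh] with s h1 h2 h3 h4
  rw [hft, Real.norm_eq_abs] at h1
  rw [hht, Real.norm_eq_abs] at h2
  rw [Real.norm_eq_abs]
  exact abs_le.2 ⟨by linarith [(abs_le.1 h1).1], by linarith [(abs_le.1 h2).2]⟩

theorem hasDerivAt_log_det {C : ℝ → Matrix (Fin d) (Fin d) ℝ} {C' : Matrix (Fin d) (Fin d) ℝ}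
    {t : ℝ} (hpos : ∀ s, (C s).PosDef) (hC : HasDerivAt C C' t) :
    HasDerivAt (fun s => Real.log (C s).det) ((C t)⁻¹ * C').trace t := by
  have hdet := (hpos t).det_pos.ne'
  have hu : IsUnit (C t).det := hdet.isUnit
  have h1 := hasDerivAt_trace (hC.const_mul (C t)⁻¹)
  have h2 := hasDerivAt_trace ((hasDerivAt_matrix_inv hC hdet).mul_const (C t))
  refine HasDerivAt.squeeze (f := fun s => Real.log (C t).det + d - ((C s)⁻¹ * C t).trace)
    (h := fun s => Real.log (C t).det - d + ((C t)⁻¹ * C s).trace) ?_ (h1.const_add _) ?_ ?_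
    (.of_forall fun s => ?_) (.of_forall fun s => ?_)
  · convert! h2.const_sub (Real.log (C t).det + d) using 1
    rw [neg_mul, Matrix.trace_neg, neg_neg, mul_assoc, Matrix.nonsing_inv_mul _ hu, mul_one]
  · simp [Matrix.nonsing_inv_mul _ hu]
  · simp [Matrix.nonsing_inv_mul _ hu]
  · linarith [(hpos s).log_det_sub_log_det_le (hpos t)]
  · linarith [(hpos t).log_det_sub_log_det_le (hpos s)]

/-- Near the identity, symmetric matrices have a differentiable symmetric square root. -/
theorem exists_hasFDerivAt_symm_sqrt :
    ∃ g : Matrix (Fin d) (Fin d) ℝ → Matrix (Fin d) (Fin d) ℝ, g 1 = 1 ∧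
      HasFDerivAt g ((1 / 2 : ℝ) • ContinuousLinearMap.id ℝ (Matrix (Fin d) (Fin d) ℝ)) 1 ∧
      ∀ᶠ Y in 𝓝 (1 : Matrix (Fin d) (Fin d) ℝ), Yᵀ = Y → (g Y)ᵀ = g Y ∧ g Y * g Y = Y := by
  let T : Matrix (Fin d) (Fin d) ℝ →L[ℝ] Matrix (Fin d) (Fin d) ℝ :=
    LinearMap.toContinuousLinearMap (Matrix.transposeLinearEquiv (Fin d) (Fin d) ℝ ℝ).toLinearMap
  have hT (X) : T X = Xᵀ := rfl
  let f : Matrix (Fin d) (Fin d) ℝ → Matrix (Fin d) (Fin d) ℝ := fun X => X * T X + (X - T X)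
  let e : Matrix (Fin d) (Fin d) ℝ ≃L[ℝ] Matrix (Fin d) (Fin d) ℝ :=
    ContinuousLinearEquiv.smulLeft (Units.mk0 (2 : ℝ) two_ne_zero)
  have hf1 : f 1 = 1 := by simp [f, hT]
  have hf : HasStrictFDerivAt f (e : Matrix (Fin d) (Fin d) ℝ →L[ℝ] _) 1 := by
    have := ((hasStrictFDerivAt_id (𝕜 := ℝ) (1 : Matrix (Fin d) (Fin d) ℝ)).mul'
      T.hasStrictFDerivAt).add ((hasStrictFDerivAt_id (𝕜 := ℝ) 1).sub T.hasStrictFDerivAt)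
    convert! this using 1
    ext1 X
    change (2 : ℝ) • X = 1 * Xᵀ + X * 1ᵀ + (X - Xᵀ)
    rw [two_smul, one_mul, Matrix.transpose_one, mul_one]
    abel
  refine ⟨hf.localInverse f e 1, ?_, ?_, ?_⟩
  · exact (congrArg (hf.localInverse f e 1) hf1.symm).trans hf.localInverse_apply_image
  · have := hf.to_localInverse.hasFDerivAt
    rw [hf1] at this
    convert! this using 1
    ext1 X
    change (1 / 2 : ℝ) • X = ((Units.mk0 (2 : ℝ) two_ne_zero)⁻¹ : ℝˣ) • X
    simp [Units.smul_def]
  · have := hf.eventually_right_inverse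
    rw [hf1] at this
    filter_upwards [this] with Y hY hYs
    set X := hf.localInverse f e 1 Y
    have h1 : X * Xᵀ + (X - Xᵀ) = Y := hY
    have h2 : X * Xᵀ + (Xᵀ - X) = Y := by
      have := congrArg Matrix.transpose h1
      simpa [Matrix.transpose_mul, hYs] using this
    have h3 : Xᵀ = X := by
      have h4 : (2 : ℝ) • (X - Xᵀ) = 0 := by
        rw [two_smul, ← sub_self Y]
        nth_rewrite 1 [← h1]
        rw [← h2]
        abel
      exact (sub_eq_zero.1 ((smul_eq_zero.1 h4).resolve_left two_ne_zero)).symm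
    refine ⟨h3, ?_⟩
    rw [h3] at h1
    simpa using h1

/-- A differentiable curve of symmetric matrices through `S * S` locally factors as `B * Bᵀ`
with `B` differentiable and passing through `S`. -/
theorem exists_hasDerivAt_factor {C : ℝ → Matrix (Fin d) (Fin d) ℝ}
    {C' S : Matrix (Fin d) (Fin d) ℝ} {t : ℝ} (hC : HasDerivAt C C' t)
    (hsymm : ∀ s, (C s)ᵀ = C s) (hS : Sᵀ = S) (hdet : S.det ≠ 0) (hSS : S * S = C t) :
    ∃ B : ℝ → Matrix (Fin d) (Fin d) ℝ, B t = S ∧ (∀ᶠ s in 𝓝 t, C s = B s * (B s)ᵀ) ∧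
      HasDerivAt B ((1 / 2 : ℝ) • (C' * S⁻¹)) t := by
  obtain ⟨g, hg1, hg, hgY⟩ := exists_hasFDerivAt_symm_sqrt (d := d)
  have hu : IsUnit S.det := hdet.isUnit
  have hSi : S * S⁻¹ = 1 := Matrix.mul_nonsing_inv _ hu
  have hiS : S⁻¹ * S = 1 := Matrix.nonsing_inv_mul _ hu
  have hSit : (S⁻¹)ᵀ = S⁻¹ := by rw [Matrix.transpose_nonsing_inv, hS]
  have hK : HasDerivAt (fun s => S⁻¹ * C s * S⁻¹) (S⁻¹ * C' * S⁻¹) t :=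
    (hC.const_mul _).mul_const _
  have hKt : S⁻¹ * C t * S⁻¹ = 1 := by
    rw [← hSS, ← mul_assoc, hiS, one_mul, hSi]
  refine ⟨fun s => S * g (S⁻¹ * C s * S⁻¹), ?_, ?_, ?_⟩
  · simp [hKt, hg1]
  · have := hK.continuousAt.tendsto
    rw [hKt] at this
    filter_upwards [this.eventually hgY] with s hs
    obtain ⟨h1, h2⟩ := hs (by simp [Matrix.transpose_mul, hSit, hsymm, mul_assoc])
    rw [Matrix.transpose_mul, h1, hS, mul_assoc, ← mul_assoc _ _ S, h2]
    simp only [mul_assoc, hiS, mul_one]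
    rw [← mul_assoc, hSi, one_mul]
  · rw [← hKt] at hg
    have := (hg.comp_hasDerivAt t hK).const_mul S
    convert! this using 1
    change _ = S * ((1 / 2 : ℝ) • (S⁻¹ * C' * S⁻¹))
    rw [mul_smul_comm, ← mul_assoc, ← mul_assoc, hSi, one_mul]

end MatrixCalculus

section GaussianKL

open scoped Matrix.Norms.Operator Matrix
open Filter Topology

variable {d : ℕ} {α β : ℝ} {Φ : EuclideanSpace ℝ (Fin d) → ℝ}

local notation "𝔼" => EuclideanSpace ℝ (Fin d)
local notation "lin" => Matrix.toEuclideanCLM (n := Fin d) (𝕜 := ℝ)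

/-- The Kullback–Leibler divergence of the Gaussian with mean `m` and covariance `C` from the
density `exp (-Φ)`. -/
noncomputable def gaussKL (Φ : 𝔼 → ℝ) (m : 𝔼) (C : Matrix (Fin d) (Fin d) ℝ) : ℝ :=
  ∫ θ, gaussDensity m C θ * Real.log (gaussDensity m C θ / Real.exp (-Φ θ))

/-- The rate at which the Gaussian Wasserstein gradient flow dissipates `gaussKL`, in terms of a
symmetric square root `S` of the covariance. -/
noncomputable def gaussDissipation (Φ : 𝔼 → ℝ) (m : 𝔼) (S : Matrix (Fin d) (Fin d) ℝ) : ℝ :=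
  ‖gaussGradient Φ m S‖ ^ 2 + ∑ i, ∑ k, (gaussHessian Φ m S * S - S⁻¹) i k ^ 2

theorem sum_mul_eq_trace (X Y : Matrix (Fin d) (Fin d) ℝ) :
    ∑ i, ∑ k, X i k * Y i k = (X * Yᵀ).trace := by
  simp [Matrix.trace, Matrix.mul_apply]

theorem HessianBetween.gaussKL_eq (h : HessianBetween Φ α β) (m : 𝔼)
    {A : Matrix (Fin d) (Fin d) ℝ} (hA : A.det ≠ 0) :
    gaussKL Φ m (A * Aᵀ) = ∫ z, Φ (m + lin A z) ∂stdGaussMeasure d -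
      1 / 2 * Real.log (A * Aᵀ).det - d / 2 * (Real.log (2 * Real.pi) + 1) := by
  have hpt (z : 𝔼) : Real.log (gaussDensity m (A * Aᵀ) (m + lin A z) /
      Real.exp (-Φ (m + lin A z))) = Φ (m + lin A z) +
      (-(1 / 2 * Real.log (A * Aᵀ).det) - d / 2 * Real.log (2 * Real.pi) -
        1 / 2 * ‖z‖ ^ 2) := by
    have h1 : 0 < |A.det| := abs_pos.2 hA
    rw [gaussDensity_add_toEuclideanCLM m hA, gaussDensity_zero_one,
      Real.log_div (by positivity) (by positivity), Real.log_mul (by positivity) (by positivity),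
      Real.log_mul (by positivity) (by positivity), Real.log_exp, Real.log_exp, Real.log_inv,
      Real.log_inv, Real.log_sqrt (by positivity), Real.log_pow, Real.log_abs, Matrix.det_mul,
      Matrix.det_transpose, Real.log_mul hA hA]
    ring
  have hsq : Integrable (fun z : 𝔼 => 1 / 2 * ‖z‖ ^ 2) (stdGaussMeasure d) :=
    (integrable_stdGaussMeasure_of_le (c := 1) (by fun_prop) fun z => by simp).const_mul _
  have hsq' : ∫ z : 𝔼, ‖z‖ ^ 2 ∂stdGaussMeasure d = d := by
    have := integral_norm_sq_affine_stdGaussMeasure (d := d) 0 1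
    simpa [Matrix.one_apply] using this
  have := integral_gaussDensity_smul m hA
    fun θ => Real.log (gaussDensity m (A * Aᵀ) θ / Real.exp (-Φ θ))
  simp only [smul_eq_mul] at this
  rw [gaussKL, this]
  simp only [hpt]
  have hsub : Integrable (fun z : 𝔼 => -(1 / 2 * Real.log (A * Aᵀ).det) -
      d / 2 * Real.log (2 * Real.pi) - 1 / 2 * ‖z‖ ^ 2) (stdGaussMeasure d) :=
    (integrable_const _).sub hsq
  rw [integral_add (h.integrable_comp m (lin A)) hsub,
    integral_sub (integrable_const _) hsq, integral_const_mul, hsq']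
  simp
  ring

theorem neg_le_mul_add_sq (hα : 0 < α) (a b : ℝ) :
    -(1 / (2 * α)) * b ^ 2 ≤ a * b + α / 2 * a ^ 2 := by
  have : a * b + α / 2 * a ^ 2 - -(1 / (2 * α)) * b ^ 2 = (α * a + b) ^ 2 / (2 * α) := by
    field_simp
    ring
  have h2 : 0 ≤ (α * a + b) ^ 2 / (2 * α) := by positivity
  linarith

/-- Polyak–Łojasiewicz inequality for the Gaussian variational problem. -/
theorem HessianBetween.gaussKL_sub_le (h : HessianBetween Φ α β) (hα : 0 < α) (m₀ m₁ : 𝔼)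
    {S C : Matrix (Fin d) (Fin d) ℝ} (hS : S.PosDef) (hC : C.PosDef) :
    gaussKL Φ m₀ (S * S) - gaussKL Φ m₁ C ≤ 1 / (2 * α) * gaussDissipation Φ m₀ S := by
  have hu : IsUnit S.det := hS.det_pos.ne'.isUnit
  have hSi : S * S⁻¹ = 1 := Matrix.mul_nonsing_inv _ hu
  have hiS : S⁻¹ * S = 1 := Matrix.nonsing_inv_mul _ hu
  have hSt : Sᵀ = S := by simpa using hS.isHermitian.eq
  have hSit : (S⁻¹)ᵀ = S⁻¹ := by rw [Matrix.transpose_nonsing_inv, hSt]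
  obtain ⟨R, hR, hRR⟩ : ∃ R : Matrix (Fin d) (Fin d) ℝ, R.PosDef ∧ R * R = S * C * S := by
    refine Matrix.PosDef.exists_posDef_mul_self ?_
    have := hC.conjTranspose_mul_mul_same (B := S) (Matrix.mulVec_injective_of_isUnit hS.isUnit)
    rwa [hS.isHermitian.eq] at this
  have hRt : Rᵀ = R := by simpa using hR.isHermitian.eq
  have hM : (S⁻¹ * R * S⁻¹).PosDef := by
    have := hR.conjTranspose_mul_mul_same (B := S⁻¹)
      (Matrix.mulVec_injective_of_isUnit hS.inv.isUnit)
    rwa [hS.inv.isHermitian.eq] at this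
  set M := S⁻¹ * R * S⁻¹ with hMdef
  have hB : (M * S) * (M * S)ᵀ = C := by
    have h1 : M * S = S⁻¹ * R := by rw [hMdef, mul_assoc _ _ S, hiS, mul_one]
    rw [h1, Matrix.transpose_mul, hRt, hSit, mul_assoc, ← mul_assoc R, hRR, mul_assoc, hSi,
      mul_one, ← mul_assoc, hiS, one_mul]
  clear_value M
  have hBdet : (M * S).det ≠ 0 := by
    rw [Matrix.det_mul]
    exact mul_ne_zero hM.det_pos.ne' hS.det_pos.ne'
  have hlog : Real.log C.det ≤ Real.log (S * S).det + 2 * ∑ i, ∑ k, (M * S - S) i k * S⁻¹ i k := by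
    rw [sum_mul_eq_trace, hSit, sub_mul, mul_assoc, hSi, mul_one, Matrix.trace_sub,
      Matrix.trace_one, ← hB, Matrix.det_mul, Matrix.det_transpose, Matrix.det_mul M,
      Matrix.det_mul S,
      Real.log_mul (mul_ne_zero hM.det_pos.ne' hS.det_pos.ne')
        (mul_ne_zero hM.det_pos.ne' hS.det_pos.ne'),
      Real.log_mul hM.det_pos.ne' hS.det_pos.ne', Real.log_mul hS.det_pos.ne' hS.det_pos.ne']
    have := hM.log_det_le_trace_sub
    simp only [Fintype.card_fin]
    linarith
  have hlow := h.integral_comp_lower m₀ (m₁ - m₀) S (M * S - S)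
  rw [add_sub_cancel, add_sub_cancel] at hlow
  have h0 := h.gaussKL_eq m₀ hS.det_pos.ne'
  have h1 := h.gaussKL_eq m₁ hBdet
  rw [hSt] at h0
  rw [hB] at h1
  have hg : -(1 / (2 * α)) * ‖gaussGradient Φ m₀ S‖ ^ 2 ≤
      inner ℝ (gaussGradient Φ m₀ S) (m₁ - m₀) + α / 2 * ‖m₁ - m₀‖ ^ 2 := by
    have := neg_le_mul_add_sq hα (-‖m₁ - m₀‖) ‖gaussGradient Φ m₀ S‖
    have h2 := neg_le_of_abs_le (abs_real_inner_le_norm (gaussGradient Φ m₀ S) (m₁ - m₀))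
    nlinarith
  have hG : -(1 / (2 * α)) * ∑ i, ∑ k, (gaussHessian Φ m₀ S * S - S⁻¹) i k ^ 2 ≤
      ∑ i, ∑ k, (M * S - S) i k * (gaussHessian Φ m₀ S * S) i k -
        ∑ i, ∑ k, (M * S - S) i k * S⁻¹ i k + α / 2 * ∑ i, ∑ k, (M * S - S) i k ^ 2 := by
    simp only [Finset.mul_sum, ← Finset.sum_sub_distrib, ← Finset.sum_add_distrib]
    refine Finset.sum_le_sum fun i _ => Finset.sum_le_sum fun k _ => ?_
    rw [← mul_sub, ← Matrix.sub_apply (gaussHessian Φ m₀ S * S)]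
    exact neg_le_mul_add_sq hα _ _
  rw [gaussDissipation]
  linarith

/-- Energy dissipation along the Gaussian Wasserstein gradient flow. -/
theorem HessianBetween.hasDerivAt_gaussKL (h : HessianBetween Φ α β) {m : ℝ → 𝔼}
    {C : ℝ → Matrix (Fin d) (Fin d) ℝ} {S : Matrix (Fin d) (Fin d) ℝ} {t : ℝ}
    (hpos : ∀ s, (C s).PosDef) (hS : S.PosDef) (hSS : S * S = C t)
    (hm : HasDerivAt m (-gaussGradient Φ (m t) S) t)
    (hC : HasDerivAt C ((2 : ℝ) • (1 : Matrix (Fin d) (Fin d) ℝ) -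
      gaussHessian Φ (m t) S * C t - C t * gaussHessian Φ (m t) S) t) :
    HasDerivAt (fun s => gaussKL Φ (m s) (C s)) (-gaussDissipation Φ (m t) S) t := by
  have hu : IsUnit S.det := hS.det_pos.ne'.isUnit
  have hSi : S * S⁻¹ = 1 := Matrix.mul_nonsing_inv _ hu
  have hiS : S⁻¹ * S = 1 := Matrix.nonsing_inv_mul _ hu
  have hSt : Sᵀ = S := by simpa using hS.isHermitian.eq
  have hSit : (S⁻¹)ᵀ = S⁻¹ := by rw [Matrix.transpose_nonsing_inv, hSt]
  have hHt : (gaussHessian Φ (m t) S)ᵀ = gaussHessian Φ (m t) S := h.isSymm_gaussHessian _ _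
  obtain ⟨B, hBt, hCB, hB⟩ := exists_hasDerivAt_factor hC
    (fun s => by simpa using (hpos s).isHermitian.eq) hSt hS.det_pos.ne' hSS
  set H := gaussHessian Φ (m t) S with hH
  set g := gaussGradient Φ (m t) S with hg
  set C' := (2 : ℝ) • (1 : Matrix (Fin d) (Fin d) ℝ) - H * C t - C t * H with hC'
  have hΦ : HasDerivAt (fun s => ∫ z, Φ (m s + lin (B s) z) ∂stdGaussMeasure d)
      (-‖g‖ ^ 2 + ∑ i, ∑ k, ((1 / 2 : ℝ) • (C' * S⁻¹)) i k * (H * S) i k) t := by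
    have key (c : ℝ) : HasDerivAt (fun s => ∫ z, Φ (m t + lin S z) ∂stdGaussMeasure d +
        inner ℝ g (m s - m t) + ∑ i, ∑ k, (B s - S) i k * (H * S) i k +
        c / 2 * (‖m s - m t‖ ^ 2 + ∑ i, ∑ k, (B s - S) i k ^ 2))
        (-‖g‖ ^ 2 + ∑ i, ∑ k, ((1 / 2 : ℝ) • (C' * S⁻¹)) i k * (H * S) i k) t := by
      have hms := hm.sub_const (m t)
      have hBs (i k) := hasDerivAt_matrix.1 (hB.sub_const S) i k
      have h1 := (hasDerivAt_const t g).inner ℝ hms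
      have h2 := HasDerivAt.fun_sum (u := Finset.univ) fun i _ => HasDerivAt.fun_sum
        (u := Finset.univ) fun k _ => (hBs i k).mul_const ((H * S) i k)
      have h3 := HasDerivAt.fun_sum (u := Finset.univ) fun i _ => HasDerivAt.fun_sum
        (u := Finset.univ) fun k _ => (hBs i k).fun_pow 2
      have h4 := ((h1.const_add (∫ z, Φ (m t + lin S z) ∂stdGaussMeasure d)).add h2).add
        ((hms.norm_sq.add h3).const_mul (c / 2))
      convert! h4 using 1
      simp [hBt]
    have hs (s) := h.integral_comp_lower (m t) (m s - m t) S (B s - S)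
    have hs' (s) := h.integral_comp_upper (m t) (m s - m t) S (B s - S)
    simp only [add_sub_cancel] at hs hs'
    refine (key α).squeeze (key β) ?_ ?_ (.of_forall hs) (.of_forall hs') <;> simp [hBt]
  have hlog := hasDerivAt_log_det hpos hC
  have hKL : (fun s => gaussKL Φ (m s) (C s)) =ᶠ[𝓝 t] fun s =>
      ∫ z, Φ (m s + lin (B s) z) ∂stdGaussMeasure d -
      1 / 2 * Real.log (C s).det - d / 2 * (Real.log (2 * Real.pi) + 1) := by
    filter_upwards [hCB] with s hs
    have hdet : (B s).det ≠ 0 := by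
      intro h0
      have := (hpos s).det_pos
      rw [hs, Matrix.det_mul, h0] at this
      simp at this
    rw [hs, h.gaussKL_eq _ hdet]
  convert! ((hΦ.sub (hlog.const_mul (1 / 2))).sub_const _).congr_of_eventuallyEq hKL using 1
  have h1 : ∑ i, ∑ k, ((1 / 2 : ℝ) • (C' * S⁻¹)) i k * (H * S) i k =
      H.trace - (S * S * H * H).trace := by
    have e1 : C' * S⁻¹ * (S * H) = (2 : ℝ) • H - H * (S * S * H) - S * S * H * H := by
      rw [mul_assoc, ← mul_assoc _ S, hiS, one_mul, hC', ← hSS]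
      simp only [sub_mul, smul_mul_assoc, one_mul, mul_assoc]
    rw [sum_mul_eq_trace, Matrix.transpose_mul, hHt, hSt, smul_mul_assoc, e1, Matrix.trace_smul,
      Matrix.trace_sub, Matrix.trace_sub, Matrix.trace_smul, Matrix.trace_mul_comm H (S * S * H)]
    simp only [smul_eq_mul]
    ring
  have h2 : ((C t)⁻¹ * C').trace = 2 * (S⁻¹ * S⁻¹).trace - 2 * H.trace := by
    have e1 : S⁻¹ * S⁻¹ * C' = (2 : ℝ) • (S⁻¹ * S⁻¹) - S⁻¹ * S⁻¹ * (H * (S * S)) - H := by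
      rw [hC', ← hSS, mul_sub, mul_sub, mul_smul_comm, mul_one, mul_assoc S⁻¹ S⁻¹ (S * S * H),
        mul_assoc S S H, ← mul_assoc S⁻¹ S (S * H), hiS, one_mul, ← mul_assoc S⁻¹ S H, hiS, one_mul]
    have e2 : (S⁻¹ * S⁻¹ * (H * (S * S))).trace = H.trace := by
      rw [Matrix.trace_mul_comm, mul_assoc, mul_assoc S S, ← mul_assoc S S⁻¹, hSi, one_mul, hSi,
        mul_one]
    rw [← hSS, Matrix.mul_inv_rev, e1, Matrix.trace_sub, Matrix.trace_sub, e2, Matrix.trace_smul]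
    simp only [smul_eq_mul]
    ring
  have h3 : ∑ i, ∑ k, (H * S - S⁻¹) i k ^ 2 =
      (S * S * H * H).trace - 2 * H.trace + (S⁻¹ * S⁻¹).trace := by
    have e1 : (H * S - S⁻¹) * (S * H - S⁻¹) =
        H * (S * S * H) - H - H + S⁻¹ * S⁻¹ := by
      rw [sub_mul, mul_sub, mul_sub, mul_assoc H S S⁻¹, hSi, mul_one, ← mul_assoc S⁻¹ S H, hiS,
        one_mul]
      simp only [mul_assoc]
      abel
    simp only [pow_two]
    rw [sum_mul_eq_trace, Matrix.transpose_sub, Matrix.transpose_mul, hHt, hSt, hSit, e1,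
      Matrix.trace_add, Matrix.trace_sub, Matrix.trace_sub, Matrix.trace_mul_comm H (S * S * H)]
    ring
  rw [gaussDissipation, ← hH, ← hg, h1, h2, h3]
  ring

/-- Grönwall's inequality for exponential relaxation to a level `c`. -/
theorem le_exp_decay_of_hasDerivAt_le {F F' : ℝ → ℝ} {k c : ℝ}
    (hF : ∀ t, 0 ≤ t → HasDerivAt F (F' t) t) (hle : ∀ t, 0 ≤ t → F' t ≤ -k * (F t - c))
    {t : ℝ} (ht : 0 ≤ t) :
    F t ≤ Real.exp (-(k * t)) * F 0 + (1 - Real.exp (-(k * t))) * c := by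
  have hG (s : ℝ) (hs : 0 ≤ s) : HasDerivAt (fun s => Real.exp (k * s) * (F s - c))
      (Real.exp (k * s) * (k * 1) * (F s - c) + Real.exp (k * s) * F' s) s :=
    ((hasDerivAt_id s).const_mul k).exp.mul ((hF s hs).sub_const c)
  have hanti : AntitoneOn (fun s => Real.exp (k * s) * (F s - c)) (Set.Ici 0) := by
    refine antitoneOn_of_deriv_nonpos (convex_Ici 0)
      (fun s hs => (hG s hs).continuousAt.continuousWithinAt)
      (fun s hs => (hG s (interior_subset hs)).differentiableAt.differentiableWithinAt)
      fun s hs => ?_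
    rw [(hG s (interior_subset hs)).deriv]
    nlinarith [hle s (interior_subset hs), Real.exp_pos (k * s)]
  have h := hanti (Set.mem_Ici.2 le_rfl) (Set.mem_Ici.2 ht) ht
  simp only [mul_zero, Real.exp_zero, one_mul] at h
  have h2 := mul_le_mul_of_nonneg_left h (Real.exp_pos (-(k * t))).le
  rw [← mul_assoc, ← Real.exp_add, neg_add_cancel, Real.exp_zero, one_mul] at h2
  linarith

end GaussianKL

/-- Exponential convergence of the Gaussian approximate Wasserstein gradient flow for an
`α`-strongly logconcave, `β`-smooth target `ρ_post = e^{−Φ_R}`: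
`KL[N(m_t,C_t)‖ρ_post] ≤ e^{−2αt}·KL[N(m_0,C_0)‖ρ_post] + (1−e^{−2αt})·KL[N(m*,C*)‖ρ_post]`,
where `(m*, C*)` is a global minimizer of the Gaussian variational inference problem. -/
theorem gaussian_wasserstein_logconcave_convergence {d : ℕ}
    (ΦR : EuclideanSpace ℝ (Fin d) → ℝ) (hΦ : ContDiff ℝ 2 ΦR)
    (α β : ℝ) (hα : 0 < α) (hαβ : α ≤ β)
    -- α I ⪯ Hess Φ_R ⪯ β I
    (hconv : ∀ (θ v : EuclideanSpace ℝ (Fin d)),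
      α * ‖v‖ ^ 2 ≤ iteratedFDeriv ℝ 2 ΦR θ ![v, v] ∧
      iteratedFDeriv ℝ 2 ΦR θ ![v, v] ≤ β * ‖v‖ ^ 2)
    (ρpost : EuclideanSpace ℝ (Fin d) → ℝ) (hpost : ∀ θ, ρpost θ = Real.exp (-ΦR θ))
    (hpostint : (∫ θ, ρpost θ) = 1)
    (m : ℝ → EuclideanSpace ℝ (Fin d)) (C : ℝ → Matrix (Fin d) (Fin d) ℝ)
    (hCpos : ∀ t, (C t).PosDef)
    -- the mean equation: m' = −𝔼_{N(m,C)}[∇Φ_R]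
    (hm : ∀ t, 0 ≤ t →
      HasDerivAt m (-∫ θ, gaussDensity (m t) (C t) θ • gradient ΦR θ) t)
    -- H(t) = 𝔼_{N(m,C)}[Hess Φ_R]
    (H : ℝ → Matrix (Fin d) (Fin d) ℝ)
    (hH : ∀ t i j, H t i j = ∫ θ, iteratedFDeriv ℝ 2 ΦR θ
      ![EuclideanSpace.single i 1, EuclideanSpace.single j 1] * gaussDensity (m t) (C t) θ)
    -- the covariance equation: C' = 2I − HC − CH
    (hC : ∀ t, 0 ≤ t → ∀ i j, HasDerivAt (fun s => C s i j)
      (((2 : ℝ) • (1 : Matrix (Fin d) (Fin d) ℝ) - H t * C t - C t * H t) i j) t)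
    -- (m*, C*) is a global minimizer of Gaussian variational inference
    (mstar : EuclideanSpace ℝ (Fin d)) (Cstar : Matrix (Fin d) (Fin d) ℝ)
    (hCstar : Cstar.PosDef)
    (hmin : ∀ (m' : EuclideanSpace ℝ (Fin d)) (C' : Matrix (Fin d) (Fin d) ℝ), C'.PosDef →
      (∫ θ, gaussDensity mstar Cstar θ * Real.log (gaussDensity mstar Cstar θ / ρpost θ)) ≤
      ∫ θ, gaussDensity m' C' θ * Real.log (gaussDensity m' C' θ / ρpost θ)) :
    ∀ t, 0 ≤ t →
      (∫ θ, gaussDensity (m t) (C t) θ * Real.log (gaussDensity (m t) (C t) θ / ρpost θ)) ≤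
        Real.exp (-(2 * α * t)) *
          (∫ θ, gaussDensity (m 0) (C 0) θ *
            Real.log (gaussDensity (m 0) (C 0) θ / ρpost θ)) +
        (1 - Real.exp (-(2 * α * t))) *
          (∫ θ, gaussDensity mstar Cstar θ *
            Real.log (gaussDensity mstar Cstar θ / ρpost θ)) := by
  have h : HessianBetween ΦR α β :=
    { contDiff := hΦ
      nonneg := hα.le
      le := hαβ
      lower := fun θ v => by simpa [iteratedFDeriv_two_apply] using (hconv θ v).1
      upper := fun θ v => by simpa [iteratedFDeriv_two_apply] using (hconv θ v).2 }
  simp only [hpost]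
  choose S hS hSS using fun t => (hCpos t).exists_posDef_mul_self
  have hSt (t) : S t * (S t).transpose = C t := by
    rw [← hSS t]
    congr 1
    simpa using (hS t).isHermitian.eq
  have hH' (t) : H t = gaussHessian ΦR (m t) (S t) := by
    ext i j
    have := integral_gaussDensity_smul (m t) (hS t).det_pos.ne' fun θ =>
      iteratedFDeriv ℝ 2 ΦR θ ![EuclideanSpace.single i 1, EuclideanSpace.single j 1]
    rw [hSt t] at this
    rw [hH, gaussHessian, Matrix.of_apply]
    simpa [iteratedFDeriv_two_apply, mul_comm] using this
  have hg (t) : ∫ θ, gaussDensity (m t) (C t) θ • gradient ΦR θ =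
      gaussGradient ΦR (m t) (S t) := by
    rw [← hSt t, integral_gaussDensity_smul (m t) (hS t).det_pos.ne', gaussGradient]
  intro t ht
  refine le_exp_decay_of_hasDerivAt_le (F := fun s => gaussKL ΦR (m s) (C s))
    (F' := fun s => -gaussDissipation ΦR (m s) (S s)) (fun s hs => ?_) (fun s hs => ?_) ht
  · refine h.hasDerivAt_gaussKL hCpos (hS s) (hSS s) (hg s ▸ hm s hs) (hasDerivAt_matrix.2 ?_)
    rw [← hH' s]
    exact hC s hs
  · have := h.gaussKL_sub_le hα (m s) mstar (hS s) hCstar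
    rw [hSS s] at this
    have h2 := mul_le_mul_of_nonneg_left this (by positivity : 0 ≤ 2 * α)
    rw [← mul_assoc, mul_one_div_cancel (by positivity), one_mul] at h2
    change _ ≤ -(2 * α) * (gaussKL ΦR (m s) (C s) - gaussKL ΦR mstar Cstar)
    linarith
end

section
/- Let 0 < α ≤ β, let V : ℝ → ℝ be continuous with α ≤ V(θ) ≤ β for all θ, and let C* > 0 satisfy ∫ V(θ)·γ(θ) dθ = 1/C*, where γ(θ) = (2πC*)^{−1/2}·exp(−θ²/(2C*)) is the density of the centered Gaussian with variance C*. Then ∫ V(θ)·θ²·γ(θ) dθ ≤ (4 + 4/√π)·(log(β/α) + 1). -/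
open MeasureTheory

lemma integral_normalized_gaussian_tilt {C b : ℝ} (hC : 0 < C) (hb : 0 < b) :
    ∫ θ, (Real.sqrt (2 * Real.pi * C))⁻¹ * Real.exp (-b * θ ^ 2) =
      Real.sqrt (1 / (2 * C * b)) := by
  rw [integral_const_mul, integral_gaussian, ← Real.sqrt_inv, ← Real.sqrt_mul (by positivity)]
  congr 1
  field_simp

/-- One-dimensional bound on the second Gaussian moment of `V` at stationarity: if
`α ≤ V ≤ β` and `∫ V γ = 1/C*` for the centered Gaussian density `γ` with variance `C*`,
then `∫ V(θ) θ² γ(θ) dθ ≤ (4 + 4/√π)(log(β/α) + 1)`. -/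
theorem one_dim_stationary_second_moment_bound
    (α β : ℝ) (hα : 0 < α) (hαβ : α ≤ β)
    (V : ℝ → ℝ) (hVcont : Continuous V)
    (hVlb : ∀ θ, α ≤ V θ) (hVub : ∀ θ, V θ ≤ β)
    (Cstar : ℝ) (hCstar : 0 < Cstar)
    (γ : ℝ → ℝ)
    (hγ : ∀ θ, γ θ = (Real.sqrt (2 * Real.pi * Cstar))⁻¹ *
      Real.exp (-(θ ^ 2 / (2 * Cstar))))
    (hstat : (∫ θ, V θ * γ θ) = 1 / Cstar) :
    (∫ θ, V θ * θ ^ 2 * γ θ) ≤ (4 + 4 / Real.sqrt Real.pi) * (Real.log (β / α) + 1) := by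
  have hβ : 0 < β := hα.trans_le hαβ
  have hγpos : ∀ θ, 0 < γ θ := fun θ => by rw [hγ]; positivity
  have hγ_eq : γ = fun θ => (Real.sqrt (2 * Real.pi * Cstar))⁻¹ *
      Real.exp (-(1 / (2 * Cstar)) * θ ^ 2) := by
    funext θ
    rw [hγ]
    ring_nf
  have hγint : Integrable γ := by
    rw [hγ_eq]
    exact (integrable_exp_neg_mul_sq (by positivity)).const_mul _
  have hγone : ∫ θ, γ θ = 1 := by
    rw [hγ_eq, integral_normalized_gaussian_tilt hCstar (by positivity)]
    rw [Real.sqrt_eq_one]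
    field_simp
  have hVint : Integrable (fun θ => V θ * γ θ) :=
    not_imp_comm.1 integral_undef (by rw [hstat]; positivity)
  have hup : 1 / Cstar ≤ β := by
    rw [← hstat, ← mul_one β, ← hγone, ← integral_const_mul]
    exact integral_mono hVint (hγint.const_mul β)
      fun θ => mul_le_mul_of_nonneg_right (hVub θ) (hγpos θ).le
  have hlow : α ≤ 1 / Cstar := by
    rw [← hstat, ← mul_one α, ← hγone, ← integral_const_mul]
    exact integral_mono (hγint.const_mul α) hVint
      fun θ => mul_le_mul_of_nonneg_right (hVlb θ) (hγpos θ).le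
  have hβC : 1 ≤ β * Cstar := (div_le_iff₀ hCstar).1 hup
  have hlog0 : 0 ≤ Real.log (β * Cstar) := Real.log_nonneg hβC
  have hlog : Real.log (β * Cstar) ≤ Real.log (β / α) := by
    apply Real.log_le_log (by positivity)
    rw [div_eq_mul_inv]
    gcongr
    rw [← one_div]
    exact (le_div_iff₀ hα).2 (by rw [mul_comm]; exact (le_div_iff₀ hCstar).1 hlow)
  have hpt : ∀ θ, V θ * θ ^ 2 * γ θ ≤ 4 * Cstar * Real.log (β * Cstar) * (V θ * γ θ) +
      4 * ((Real.sqrt (2 * Real.pi * Cstar))⁻¹ *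
        Real.exp (-(1 / (4 * Cstar)) * θ ^ 2)) := by
    intro θ
    have hexp : (Real.sqrt (2 * Real.pi * Cstar))⁻¹ *
        Real.exp (-(1 / (4 * Cstar)) * θ ^ 2) = Real.exp (θ ^ 2 / (4 * Cstar)) * γ θ := by
      rw [hγ, mul_left_comm, ← Real.exp_add]
      congr 2
      field_simp
      ring
    have hy : θ ^ 2 / (4 * Cstar) - Real.log (β * Cstar) ≤
        Real.exp (θ ^ 2 / (4 * Cstar)) / (β * Cstar) := by
      have h := Real.add_one_le_exp (θ ^ 2 / (4 * Cstar) - Real.log (β * Cstar))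
      rw [Real.exp_sub, Real.exp_log (by positivity)] at h
      linarith
    have hV : V θ * (θ ^ 2 / (4 * Cstar) - Real.log (β * Cstar)) ≤
        Real.exp (θ ^ 2 / (4 * Cstar)) / Cstar := by
      calc _ ≤ V θ * (Real.exp (θ ^ 2 / (4 * Cstar)) / (β * Cstar)) :=
            mul_le_mul_of_nonneg_left hy (hα.le.trans (hVlb θ))
        _ ≤ β * (Real.exp (θ ^ 2 / (4 * Cstar)) / (β * Cstar)) :=
            mul_le_mul_of_nonneg_right (hVub θ) (by positivity)
        _ = _ := by field_simp
    have hsq : V θ * θ ^ 2 ≤ 4 * Cstar * Real.log (β * Cstar) * V θ +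
        4 * Real.exp (θ ^ 2 / (4 * Cstar)) := by
      have h := mul_le_mul_of_nonneg_left hV (by positivity : 0 ≤ 4 * Cstar)
      have h₁ : 4 * Cstar * (V θ * (θ ^ 2 / (4 * Cstar) - Real.log (β * Cstar))) =
          V θ * θ ^ 2 - 4 * Cstar * Real.log (β * Cstar) * V θ := by
        field_simp
      have h₂ : 4 * Cstar * (Real.exp (θ ^ 2 / (4 * Cstar)) / Cstar) =
          4 * Real.exp (θ ^ 2 / (4 * Cstar)) := by
        field_simp
      linarith
    rw [hexp]
    linarith [mul_le_mul_of_nonneg_right hsq (hγpos θ).le]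
  have htilt_int : Integrable fun θ : ℝ => (Real.sqrt (2 * Real.pi * Cstar))⁻¹ *
      Real.exp (-(1 / (4 * Cstar)) * θ ^ 2) :=
    (integrable_exp_neg_mul_sq (by positivity)).const_mul _
  have hbound : ∫ θ, V θ * θ ^ 2 * γ θ ≤ 4 * Real.log (β * Cstar) + 4 * Real.sqrt 2 := by
    refine (integral_mono_of_nonneg (.of_forall fun θ => ?_)
      ((hVint.const_mul _).add (htilt_int.const_mul 4)) (.of_forall hpt)).trans_eq ?_
    · exact mul_nonneg (mul_nonneg (hα.le.trans (hVlb θ)) (sq_nonneg θ)) (hγpos θ).le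
    · simp only [Pi.add_apply]
      rw [integral_add (hVint.const_mul _) (htilt_int.const_mul 4), integral_const_mul,
        integral_const_mul, hstat, integral_normalized_gaussian_tilt hCstar (by positivity)]
      have h : 1 / (2 * Cstar * (1 / (4 * Cstar))) = 2 := by
        field_simp
        norm_num
      rw [h]
      field_simp
  have hsqrt_two : Real.sqrt 2 ≤ 3 / 2 := by
    rw [Real.sqrt_le_left (by norm_num)]
    norm_num
  have hsqrt_pi : Real.sqrt Real.pi ≤ 2 := by
    rw [Real.sqrt_le_left (by norm_num)]
    linarith [Real.pi_le_four]
  have hconst : 2 ≤ 4 / Real.sqrt Real.pi := by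
    rw [le_div_iff₀ (Real.sqrt_pos.2 Real.pi_pos)]
    linarith
  nlinarith [mul_nonneg (by linarith : 0 ≤ 4 / Real.sqrt Real.pi) (hlog0.trans hlog)]
end

section
/- Let 0 < α ≤ β and let Φ : ℝ → ℝ be twice continuously differentiable with α ≤ Φ''(θ) ≤ β for all θ (so the density proportional to e^{−Φ} is α-strongly logconcave and β-smooth). Let m* ∈ ℝ and C* > 0 satisfy the stationarity conditions ∫ Φ'(θ)·γ(θ) dθ = 0 and ∫ Φ''(θ)·γ(θ) dθ = 1/C*, where γ is the Gaussian density with mean m* and variance C*. Define A₁ := ∫ Φ''(θ)·(θ − m*)·γ(θ) dθ, A₂ := ∫ Φ''(θ)·(θ − m*)²·γ(θ) dθ, and λ₂ := ( −(3/2 + A₂/2) + sqrt( (1/2 − A₂/2)² + 2·A₁²·C* ) ) / 2, the largest eigenvalue of the linearized Jacobian of the Gaussian approximate Fisher–Rao gradient flow at (m*, C*). Then λ₂ ≤ −1 / ( (7 + 4/√π)·(1 + log(β/α)) ); i.e. the local convergence rate of the Gaussian approximate Fisher–Rao gradient flow is at least 1/((7 + 4/√π)(1 + log(β/α))). -/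
open MeasureTheory

/-- The larger root of the characteristic polynomial is at most `-r` as soon as `r * (3 + b) ≤ 1`
and `q ≤ b`. -/
lemma half_neg_add_sqrt_le_neg {q b r : ℝ} (hb : 0 ≤ b) (hq : q ≤ b) (hr : 0 ≤ r)
    (hrb : r * (3 + b) ≤ 1) :
    (-(3 / 2 + b / 2) + √((1 / 2 - b / 2) ^ 2 + 2 * q)) / 2 ≤ -r := by
  have hrb0 : 0 ≤ r * b := mul_nonneg hr hb
  have h : √((1 / 2 - b / 2) ^ 2 + 2 * q) ≤ 3 / 2 + b / 2 - 2 * r := by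
    apply Real.sqrt_le_iff.mpr
    constructor
    · linarith
    · nlinarith [sq_nonneg r]
  linarith

/-- A pointwise bound of Young type with `4 * log k` in place of the dual variable. -/
lemma le_four_log_add_exp {k : ℝ} (hk : 0 < k) (u : ℝ) :
    u ≤ 4 * Real.log k - 4 + 4 / k * Real.exp (u / 4) := by
  have h := Real.add_one_le_exp (u / 4 - Real.log k)
  rw [Real.exp_sub, Real.exp_log hk] at h
  have e : 4 / k * Real.exp (u / 4) = 4 * (Real.exp (u / 4) / k) := by ring
  rw [e]
  linarith

lemma integral_exp_neg_sq_sub_div (m c : ℝ) :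
    ∫ θ : ℝ, Real.exp (-((θ - m) ^ 2 / c)) = √(Real.pi * c) := by
  rw [integral_sub_right_eq_self (fun x : ℝ => Real.exp (-(x ^ 2 / c))) m]
  have h := integral_gaussian c⁻¹
  rw [div_inv_eq_mul] at h
  rw [← h]
  congr 1 with x
  congr 1
  ring

lemma integrable_pow_mul_exp_neg_sq_sub_div (m : ℝ) {c : ℝ} (hc : 0 < c) (n : ℕ) :
    Integrable fun θ : ℝ => (θ - m) ^ n * Real.exp (-((θ - m) ^ 2 / c)) := by
  have h := integrable_rpow_mul_exp_neg_mul_sq (inv_pos.mpr hc) (s := (n : ℝ))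
    (by have := n.cast_nonneg (α := ℝ); linarith)
  refine (h.comp_sub_right m).congr (.of_forall fun θ => ?_)
  simp only [Real.rpow_natCast]
  congr 2
  ring

/-- Lower bound on the local convergence rate of the one-dimensional Gaussian approximate
Fisher–Rao gradient flow at its stationary point `(m*, C*)`, for an `α`-strongly logconcave,
`β`-smooth target `ρ_post ∝ e^{−Φ}`: the largest eigenvalue `λ₂` of the linearized Jacobian
satisfies `λ₂ ≤ −1/((7 + 4/√π)(1 + log(β/α)))`. -/
theorem gaussian_fisherRao_local_rate
    (α β : ℝ) (hα : 0 < α) (hαβ : α ≤ β)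
    (Φ : ℝ → ℝ) (hΦ : ContDiff ℝ 2 Φ)
    (hHess : ∀ θ, α ≤ deriv (deriv Φ) θ ∧ deriv (deriv Φ) θ ≤ β)
    (mstar Cstar : ℝ) (hCstar : 0 < Cstar)
    (γ : ℝ → ℝ)
    (hγ : ∀ θ, γ θ = (Real.sqrt (2 * Real.pi * Cstar))⁻¹ *
      Real.exp (-((θ - mstar) ^ 2 / (2 * Cstar))))
    -- stationarity conditions
    (hstat1 : (∫ θ, deriv Φ θ * γ θ) = 0)
    (hstat2 : (∫ θ, deriv (deriv Φ) θ * γ θ) = 1 / Cstar)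
    -- the coefficients of the linearized Jacobian and its largest eigenvalue
    (A₁ A₂ lam₂ : ℝ)
    (hA₁ : A₁ = ∫ θ, deriv (deriv Φ) θ * (θ - mstar) * γ θ)
    (hA₂ : A₂ = ∫ θ, deriv (deriv Φ) θ * (θ - mstar) ^ 2 * γ θ)
    (hlam : lam₂ = (-(3 / 2 + A₂ / 2) +
      Real.sqrt ((1 / 2 - A₂ / 2) ^ 2 + 2 * A₁ ^ 2 * Cstar)) / 2) :
    lam₂ ≤ -(1 / ((7 + 4 / Real.sqrt Real.pi) * (1 + Real.log (β / α)))) := by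
  set h : ℝ → ℝ := deriv (deriv Φ)
  have hcont : Continuous h := by
    have h1 : ContDiff ℝ 1 (deriv Φ) := ContDiff.deriv' (by rw [one_add_one_eq_two]; exact hΦ)
    exact h1.continuous_deriv le_rfl
  have hβ : 0 < β := hα.trans_le hαβ
  have hγ' : γ = fun θ => (√(2 * Real.pi * Cstar))⁻¹ *
      Real.exp (-((θ - mstar) ^ 2 / (2 * Cstar))) := funext hγ
  have hγ0 : ∀ θ, 0 ≤ γ θ := fun θ => by rw [hγ]; positivity
  have hint : ∀ n : ℕ, Integrable fun θ => (θ - mstar) ^ n * γ θ := fun n => by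
    refine ((integrable_pow_mul_exp_neg_sq_sub_div mstar (c := 2 * Cstar) (by positivity) n).const_mul
      (√(2 * Real.pi * Cstar))⁻¹).congr (.of_forall fun θ => ?_)
    simp only [hγ]
    ring
  have hinth : ∀ n : ℕ, Integrable fun θ => h θ * ((θ - mstar) ^ n * γ θ) := fun n => by
    refine (hint n).bdd_mul (c := β) hcont.aestronglyMeasurable (.of_forall fun θ => ?_)
    rw [Real.norm_of_nonneg (hα.le.trans (hHess θ).1)]
    exact (hHess θ).2
  have i0 : Integrable fun θ => h θ * γ θ := by simpa using hinth 0
  have i1 : Integrable fun θ => h θ * (θ - mstar) * γ θ := by simpa [mul_assoc] using hinth 1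
  have i2 : Integrable fun θ => h θ * (θ - mstar) ^ 2 * γ θ := by
    simpa [mul_assoc] using hinth 2
  have iγ : Integrable γ := by simpa using hint 0
  have mass : ∫ θ, γ θ = 1 := by
    rw [hγ', integral_const_mul, integral_exp_neg_sq_sub_div,
      show Real.pi * (2 * Cstar) = 2 * Real.pi * Cstar by ring]
    exact inv_mul_cancel₀ (by positivity)
  have hexp : ∀ θ, Real.exp ((θ - mstar) ^ 2 / Cstar / 4) * γ θ =
      (√(2 * Real.pi * Cstar))⁻¹ * Real.exp (-((θ - mstar) ^ 2 / (4 * Cstar))) := fun θ => by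
    rw [hγ, mul_left_comm, ← Real.exp_add]
    congr 2
    field_simp
    ring
  have iE : Integrable fun θ => Real.exp ((θ - mstar) ^ 2 / Cstar / 4) * γ θ := by
    simp only [hexp]
    simpa using (integrable_pow_mul_exp_neg_sq_sub_div mstar
      (c := 4 * Cstar) (by positivity) 0).const_mul (√(2 * Real.pi * Cstar))⁻¹
  have vE : ∫ θ, Real.exp ((θ - mstar) ^ 2 / Cstar / 4) * γ θ = √2 := by
    simp only [hexp]
    rw [integral_const_mul, integral_exp_neg_sq_sub_div,
      show Real.pi * (4 * Cstar) = (2 * Real.pi * Cstar) * 2 by ring,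
      Real.sqrt_mul (x := 2 * Real.pi * Cstar) (by positivity), inv_mul_cancel_left₀]
    positivity
  have hαC : α * Cstar ≤ 1 := by
    have : ∫ θ, α * γ θ ≤ ∫ θ, h θ * γ θ :=
      integral_mono (iγ.const_mul α) i0
        fun θ => mul_le_mul_of_nonneg_right (hHess θ).1 (hγ0 θ)
    rw [integral_const_mul, mass, hstat2, mul_one, le_div_iff₀ hCstar] at this
    exact this
  have hcs : A₁ ^ 2 * Cstar ≤ A₂ := by
    have h0 : 0 ≤ ∫ θ, h θ * (θ - mstar - A₁ * Cstar) ^ 2 * γ θ :=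
      integral_nonneg fun θ => mul_nonneg
        (mul_nonneg (hα.le.trans (hHess θ).1) (sq_nonneg _)) (hγ0 θ)
    have e : (fun θ => h θ * (θ - mstar - A₁ * Cstar) ^ 2 * γ θ) = fun θ =>
        h θ * (θ - mstar) ^ 2 * γ θ - 2 * (A₁ * Cstar) * (h θ * (θ - mstar) * γ θ)
          + (A₁ * Cstar) ^ 2 * (h θ * γ θ) := by
      funext θ; ring
    have hsub : Integrable fun θ => h θ * (θ - mstar) ^ 2 * γ θ -
        2 * (A₁ * Cstar) * (h θ * (θ - mstar) * γ θ) := i2.sub (i1.const_mul _)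
    rw [e, integral_add hsub (i0.const_mul _),
      integral_sub i2 (i1.const_mul _), integral_const_mul, integral_const_mul, ← hA₁, ← hA₂,
      hstat2] at h0
    have e2 : (A₁ * Cstar) ^ 2 * (1 / Cstar) = A₁ ^ 2 * Cstar := by field_simp
    rw [e2] at h0
    linarith
  have hκ : 0 < β / α := by positivity
  have hL : 0 ≤ Real.log (β / α) := Real.log_nonneg ((one_le_div hα).mpr hαβ)
  set L := Real.log (β / α)
  have hA₂0 : 0 ≤ A₂ := le_trans (by positivity) hcs
  have hA₂le : A₂ ≤ 4 * L - 4 + 4 * √2 := by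
    have hpt : ∀ θ, h θ * (θ - mstar) ^ 2 * γ θ ≤
        Cstar * (4 * L - 4) * (h θ * γ θ) +
          4 * α * Cstar * (Real.exp ((θ - mstar) ^ 2 / Cstar / 4) * γ θ) := fun θ => by
      have h1 := le_four_log_add_exp hκ ((θ - mstar) ^ 2 / Cstar)
      rw [div_le_iff₀ hCstar] at h1
      have h0 : 0 ≤ h θ := hα.le.trans (hHess θ).1
      set E := Real.exp ((θ - mstar) ^ 2 / Cstar / 4)
      have hE : h θ * (4 / (β / α) * E) ≤ 4 * α * E := by
        calc h θ * (4 / (β / α) * E) ≤ β * (4 / (β / α) * E) :=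
              mul_le_mul_of_nonneg_right (hHess θ).2 (by positivity)
          _ = 4 * α * E := by field_simp
      have h2 : h θ * (θ - mstar) ^ 2 ≤
          Cstar * (4 * L - 4) * h θ + 4 * α * Cstar * E := by
        nlinarith [mul_le_mul_of_nonneg_left h1 h0, mul_le_mul_of_nonneg_left hE hCstar.le]
      nlinarith [mul_le_mul_of_nonneg_right h2 (hγ0 θ)]
    have := integral_mono i2 ((i0.const_mul _).add (iE.const_mul _)) hpt
    simp only [Pi.add_apply] at this
    rw [← hA₂, integral_add (i0.const_mul _) (iE.const_mul _), integral_const_mul,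
      integral_const_mul, hstat2, vE] at this
    have e : Cstar * (4 * L - 4) * (1 / Cstar) = 4 * L - 4 := by field_simp
    nlinarith [Real.sqrt_nonneg 2]
  have hs2 : √2 ≤ 2 := Real.sqrt_le_iff.mpr ⟨by norm_num, by norm_num⟩
  have hK : 0 ≤ 4 / √Real.pi := by positivity
  rw [hlam, mul_assoc 2]
  refine half_neg_add_sqrt_le_neg hA₂0 hcs (by positivity) ?_
  rw [one_div, inv_mul_le_iff₀ (by positivity)]
  nlinarith [mul_nonneg hK hL]
end

section
/- Let K ≥ 1 be a natural number and let C : [0,∞) → ℝ be differentiable with C'(t) = −C(t)·(C(t) − 1)^{2K+1} for all t ≥ 0 and 1 < C(0) ≤ 2. Then for all t ≥ 0: 1 < C(t) ≤ C(0), and C(t) − 1 ≥ ( (C(0) − 1)^{−2K} + 4K·t )^{−1/(2K)}. In particular C(t) converges to the stationary value 1 no faster than the algebraic rate t^{−1/(2K)}, so the convergence of a gradient flow whose covariance obeys this equation can be arbitrarily slow as K grows. -/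
/-- A solution of `y' = -g y` on `[0, ∞)` with continuous coefficient `g` that starts positive
stays positive. -/
theorem pos_of_hasDerivWithinAt_neg_mul {y g : ℝ → ℝ}
    (hg : ContinuousOn g (Set.Ici 0))
    (hy : ∀ t, 0 ≤ t → HasDerivWithinAt y (-(g t) * y t) (Set.Ici 0) t)
    (h0 : 0 < y 0) {T : ℝ} (hT : 0 ≤ T) : 0 < y T := by
  have hyc : ContinuousOn y (Set.Ici 0) := fun t ht => (hy t ht).continuousWithinAt
  have hsub : ∀ T : ℝ, Set.Icc 0 T ⊆ Set.Ici (0 : ℝ) := fun _ => Set.Icc_subset_Ici_self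
  have hne : ∀ T, 0 ≤ T → y T ≠ 0 := by
    intro T hT hyT
    obtain ⟨M, hM⟩ := (isCompact_Icc (a := (0 : ℝ)) (b := T)).bddAbove_image (hg.mono (hsub T))
    have hder : ∀ t, 0 ≤ t → HasDerivWithinAt (fun t => y t ^ 2 * Real.exp (2 * M * t))
        (2 * (M - g t) * (y t ^ 2 * Real.exp (2 * M * t))) (Set.Ici 0) t := by
      intro t ht
      have h := ((hy t ht).pow 2).mul
        ((((hasDerivAt_id t).const_mul (2 * M)).exp).hasDerivWithinAt (s := Set.Ici 0))
      refine h.congr_deriv ?_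
      simp
      ring
    have hmono : MonotoneOn (fun t => y t ^ 2 * Real.exp (2 * M * t)) (Set.Icc 0 T) := by
      refine monotoneOn_of_hasDerivWithinAt_nonneg (convex_Icc 0 T)
        (fun t ht => ((hder t ht.1).continuousWithinAt).mono (hsub T))
        (fun t ht => (hder t (interior_subset ht).1).mono (interior_subset.trans (hsub T))) ?_
      intro t ht
      have hgt : g t ≤ M := hM (Set.mem_image_of_mem g (interior_subset ht))
      have : 0 ≤ M - g t := sub_nonneg.2 hgt
      positivity
    have h := hmono (Set.left_mem_Icc.2 hT) (Set.right_mem_Icc.2 hT) hT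
    simp only [hyT, mul_zero, Real.exp_zero, mul_one] at h
    simp at h
    exact h0.ne' h
  by_contra! hneg
  obtain ⟨s, hs, hs0⟩ := intermediate_value_Icc' hT (hyc.mono (hsub T)) ⟨hneg, h0.le⟩
  exact hne s hs.1 hs0

/-- Arbitrarily slow algebraic convergence of the covariance ODE
`C' = −C (C − 1)^{2K+1}`: if `1 < C(0) ≤ 2` then `1 < C(t) ≤ C(0)` and
`C(t) − 1 ≥ ((C(0) − 1)^{−2K} + 4Kt)^{−1/(2K)}` for all `t ≥ 0`, so `C(t)` converges to the
stationary value `1` no faster than the algebraic rate `t^{−1/(2K)}`. -/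
theorem slow_convergence_of_covariance_ode (K : ℕ) (hK : 1 ≤ K)
    (C : ℝ → ℝ)
    (hC : ∀ t, 0 ≤ t →
      HasDerivWithinAt C (-(C t) * (C t - 1) ^ (2 * K + 1)) (Set.Ici 0) t)
    (h0 : 1 < C 0) (h0' : C 0 ≤ 2) :
    ∀ t, 0 ≤ t →
      (1 < C t ∧ C t ≤ C 0) ∧
      ((C 0 - 1) ^ (-(2 * (K : ℝ))) + 4 * K * t) ^ (-(1 / (2 * (K : ℝ)))) ≤ C t - 1 := by
  have hCc : ContinuousOn C (Set.Ici 0) := fun t ht => (hC t ht).continuousWithinAt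
  have hpos : ∀ t, 0 ≤ t → 0 < C t - 1 := fun t ht =>
    pos_of_hasDerivWithinAt_neg_mul (y := fun t => C t - 1)
      (g := fun t => C t * (C t - 1) ^ (2 * K)) (by fun_prop)
      (fun t ht => ((hC t ht).sub_const 1).congr_deriv (by ring)) (by linarith) ht
  have hint : interior (Set.Ici (0 : ℝ)) ⊆ Set.Ici 0 := interior_subset
  have hanti : AntitoneOn C (Set.Ici 0) := by
    refine antitoneOn_of_hasDerivWithinAt_nonpos (convex_Ici 0) hCc
      (fun t ht => (hC t (hint ht)).mono hint) fun t ht => ?_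
    have h := hpos t (hint ht)
    have hCt : 0 < C t := by linarith
    rw [neg_mul, neg_nonpos]
    positivity
  have hle : ∀ t, 0 ≤ t → C t ≤ C 0 := fun t ht => hanti Set.self_mem_Ici ht ht
  have hder : ∀ t, 0 ≤ t → HasDerivWithinAt (fun t => 4 * K * t - ((C t - 1) ^ (2 * K))⁻¹)
      (4 * K - 2 * K * C t) (Set.Ici 0) t := by
    intro t ht
    have hp := hpos t ht
    have h := ((hasDerivAt_id t).const_mul (4 * (K : ℝ))).hasDerivWithinAt (s := Set.Ici 0) |>.sub
      ((((hC t ht).sub_const 1).pow (2 * K)).inv (pow_ne_zero _ hp.ne'))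
    refine h.congr_deriv ?_
    obtain ⟨n, hn⟩ : ∃ n, 2 * K = n + 1 := ⟨2 * K - 1, by omega⟩
    have hn' : (2 * K : ℝ) = n + 1 := by exact_mod_cast hn
    have hq : C t - 1 ≠ 0 := hp.ne'
    simp only [hn, hn', Nat.add_sub_cancel, mul_one, Nat.cast_add, Nat.cast_one, Pi.pow_apply]
    field_simp
    ring
  have hmono : MonotoneOn (fun t => 4 * K * t - ((C t - 1) ^ (2 * K))⁻¹) (Set.Ici 0) := by
    refine monotoneOn_of_hasDerivWithinAt_nonneg (convex_Ici 0)
      (fun t ht => (hder t ht).continuousWithinAt)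
      (fun t ht => (hder t (hint ht)).mono hint) fun t ht => ?_
    have h2 : C t ≤ 2 := (hle t (hint ht)).trans h0'
    nlinarith [(Nat.cast_nonneg K : (0 : ℝ) ≤ K)]
  intro t ht
  have hp := hpos t ht
  refine ⟨⟨by linarith, hle t ht⟩, ?_⟩
  have hK' : (0 : ℝ) < 2 * K := by positivity
  have hrpow : ∀ x : ℝ, 0 < x → x ^ (-(2 * (K : ℝ))) = (x ^ (2 * K))⁻¹ := by
    intro x hx
    rw [Real.rpow_neg hx.le, ← Real.rpow_natCast]
    push_cast
    rfl
  have hbound : (C t - 1) ^ (-(2 * (K : ℝ))) ≤ (C 0 - 1) ^ (-(2 * (K : ℝ))) + 4 * K * t := by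
    have h := hmono Set.self_mem_Ici ht ht
    simp only at h
    rw [hrpow _ hp, hrpow _ (hpos 0 le_rfl)]
    linarith
  calc _ ≤ ((C t - 1) ^ (-(2 * (K : ℝ)))) ^ (-(1 / (2 * (K : ℝ)))) :=
        Real.rpow_le_rpow_of_nonpos (by positivity) hbound (by simp)
    _ = C t - 1 := by
        rw [← Real.rpow_mul hp.le, neg_mul_neg, mul_one_div_cancel hK'.ne', Real.rpow_one]
end
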